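/- Let l ≥ 1 and let A be a symmetric l×l integer matrix with A_{ii} = 2 for all i, A_{ij} ∈ {0, −1} for i ≠ j, such that A is positive definite (as a real matrix) and the graph on {1,…,l} with an edge {i,j} whenever A_{ij} = −1 is connected (i.e. A is the Cartan matrix of a simply-laced simple Lie algebra, of type A, D or E). Let Φ⁺ = { c ∈ ℕ^l : cᵀ A c = 2 }, a finite set (the positive roots written in the basis of simple roots). Then in ℤ[[q, y_1, …, y_l]]: ∏_{c ∈ Φ⁺} ∏_{n≥1} (1 − q^n y_1^{c_1} ⋯ y_l^{c_l})^{−1} = ∑ over all l-tuples (r_1, …, r_l) of descending sequences of q^{E} · ( ∏_{i=1}^{l} y_i^{|r_i|} ) · ∏_{i=1}^{l} ∏_{j≥1} (q;q)_{r_i^{(j)} − r_i^{(j+1)}}^{−1}, where for each t ≥ 1 the vector c^{(t)} = (r_1^{(t)}, …, r_l^{(t)}) and E = ∑_{t≥1} (1/2) (c^{(t)})ᵀ A c^{(t)}; here E is a nonnegative integer (finitely many nonzero summands, each a nonnegative integer since A is positive definite with even diagonal). -/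

import Mathlib

/-- The product topology (coefficientwise convergence) on multivariate formal power series. -/
noncomputable instance (σ R : Type*) [TopologicalSpace R] :
    TopologicalSpace (MvPowerSeries σ R) :=
  inferInstanceAs (TopologicalSpace ((σ →₀ ℕ) → R))

/-- `r : ℕ → ℕ` is a descending sequence (indexed so that `r t = r^{(t+1)}`):
nonincreasing and eventually zero. -/
def IsDescending (r : ℕ → ℕ) : Prop :=
  Antitone r ∧ ∃ N, ∀ t ≥ N, r t = 0

/-- `∑ₛ g(s) Xˢ V(s)`, as a power series. -/
noncomputable def shiftedSum {K : Type*} [Field K] (g : ℕ → K) (V : ℕ → PowerSeries K) : PowerSeries K :=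
  PowerSeries.mk fun k => ∑ s ∈ Finset.range (k + 1), g s * PowerSeries.coeff (k - s) (V s)

namespace QSeries

open PowerSeries Finset

variable {K : Type*} [Field K]

/-- The `q`-Pochhammer symbol `(q;q)_n`. -/
def qPoch {R : Type*} [CommRing R] (q : R) (n : ℕ) : R := ∏ u ∈ range n, (1 - q ^ (u + 1))

@[simp]
lemma qPoch_zero {R : Type*} [CommRing R] (q : R) : qPoch q 0 = 1 := by simp [qPoch]

lemma qPoch_succ {R : Type*} [CommRing R] (q : R) (n : ℕ) :
    qPoch q (n + 1) = qPoch q n * (1 - q ^ (n + 1)) := prod_range_succ _ _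

lemma qPoch_ne_zero {q : K} (hq : ∀ n : ℕ, q ^ (n + 1) ≠ 1) (n : ℕ) : qPoch q n ≠ 0 :=
  prod_ne_zero_iff.2 fun u _ => sub_ne_zero.2 (hq u).symm

lemma coeff_shiftedSum (g : ℕ → K) (V : ℕ → K⟦X⟧) {k N : ℕ} (h : k < N) :
    coeff k (shiftedSum g V) = coeff k (∑ s ∈ range N, C (g s) * (X ^ s * V s)) := by
  rw [shiftedSum, coeff_mk, map_sum]
  simp only [coeff_C_mul, coeff_X_pow_mul']
  rw [← sum_subset (range_subset_range.2 (Nat.succ_le_of_lt h))]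
  · refine sum_congr rfl fun s hs => ?_
    rw [if_pos (Nat.lt_succ_iff.1 (mem_range.1 hs))]
  · intro s _ hs
    rw [if_neg (by simpa using hs), mul_zero]

lemma shiftedSum_add (g : ℕ → K) (V W : ℕ → K⟦X⟧) :
    shiftedSum g (fun s => V s + W s) = shiftedSum g V + shiftedSum g W := by
  ext k
  simp [shiftedSum, mul_add, sum_add_distrib]

lemma shiftedSum_sub (g : ℕ → K) (V W : ℕ → K⟦X⟧) :
    shiftedSum g (fun s => V s - W s) = shiftedSum g V - shiftedSum g W := by
  ext k
  simp [shiftedSum, mul_sub, sum_sub_distrib]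

lemma shiftedSum_mul_left (B : K⟦X⟧) (g : ℕ → K) (V : ℕ → K⟦X⟧) :
    shiftedSum g (fun s => B * V s) = B * shiftedSum g V := by
  ext k
  have h : coeff k (B * shiftedSum g V)
      = coeff k (B * ∑ s ∈ range (k + 1), C (g s) * (X ^ s * V s)) := by
    rw [coeff_mul, coeff_mul]
    refine sum_congr rfl fun p hp => ?_
    rw [coeff_shiftedSum g V (N := k + 1)
      (by have := mem_antidiagonal.1 hp; omega)]
  rw [h, coeff_shiftedSum _ _ (Nat.lt_succ_self k), mul_sum]
  congr 1
  refine sum_congr rfl fun s _ => ?_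
  ring

lemma shiftedSum_C_mul (a : ℕ → K) (g : ℕ → K) (V : ℕ → K⟦X⟧) :
    shiftedSum g (fun s => C (a s) * V s) = shiftedSum (fun s => g s * a s) V := by
  ext k
  simp [shiftedSum, mul_assoc]

lemma C_mul_shiftedSum (a : K) (g : ℕ → K) (V : ℕ → K⟦X⟧) :
    C a * shiftedSum g V = shiftedSum (fun s => a * g s) V := by
  ext k
  simp [shiftedSum, mul_sum, mul_assoc]

lemma rescale_shiftedSum (a : K) (g : ℕ → K) (V : ℕ → K⟦X⟧) :
    rescale a (shiftedSum g V) = shiftedSum (fun s => g s * a ^ s) fun s => rescale a (V s) := by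
  ext k
  simp only [shiftedSum, coeff_rescale, coeff_mk, mul_sum]
  refine sum_congr rfl fun s hs => ?_
  have : k = s + (k - s) := by have := mem_range.1 hs; omega
  conv_lhs => rw [this, pow_add]
  rw [Nat.add_sub_cancel_left]
  ring

lemma shiftedSum_eq_X_mul {g : ℕ → K} {V : ℕ → K⟦X⟧} (h : C (g 0) * V 0 = 0) :
    shiftedSum g V = X * shiftedSum (fun s => g (s + 1)) fun s => V (s + 1) := by
  ext k
  rw [coeff_shiftedSum g V (Nat.lt_succ_self k), sum_range_succ', pow_zero, one_mul, h, add_zero]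
  rcases k with _ | k
  · simp
  · rw [coeff_succ_X_mul, coeff_shiftedSum _ _ (Nat.lt_succ_self k), map_sum, map_sum]
    refine sum_congr rfl fun s _ => ?_
    rw [show C (g (s + 1)) * ((X : K⟦X⟧) ^ (s + 1) * V (s + 1))
      = X * (C (g (s + 1)) * (X ^ s * V (s + 1))) by ring, coeff_succ_X_mul]

/-- `1 / (qX;q)_r`. -/
noncomputable def invPochX (q : K) (r : ℕ) : K⟦X⟧ := (∏ u ∈ range r, (1 - C (q ^ (u + 1)) * X))⁻¹

lemma one_sub_C_mul_X_ne_zero (a : K) : (1 - C a * X : K⟦X⟧) ≠ 0 := by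
  intro h
  simpa using congrArg constantCoeff h

lemma prod_mul_invPochX (q : K) (r : ℕ) :
    (∏ u ∈ range r, (1 - C (q ^ (u + 1)) * X)) * invPochX q r = 1 := by
  refine PowerSeries.mul_inv_cancel _ ?_
  simp [map_prod]

@[simp]
lemma invPochX_zero (q : K) : invPochX q 0 = 1 := by simpa using prod_mul_invPochX q 0

lemma invPochX_succ (q : K) (r : ℕ) :
    (1 - C (q ^ (r + 1)) * X) * invPochX q (r + 1) = invPochX q r := by
  have h := prod_mul_invPochX q (r + 1)
  have h' := prod_mul_invPochX q r
  rw [prod_range_succ] at h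
  refine mul_left_cancel₀ (a := ∏ u ∈ range r, (1 - C (q ^ (u + 1)) * X)) ?_ ?_
  · exact prod_ne_zero_iff.2 fun u _ => one_sub_C_mul_X_ne_zero _
  · linear_combination h - h'

lemma rescale_C (a b : K) : rescale a (C b) = (C b : K⟦X⟧) := by
  ext k
  rcases k with _ | k <;> simp [coeff_rescale, coeff_C]

lemma rescale_invPochX (q : K) (r : ℕ) :
    (1 - C q * X) * invPochX q (r + 1) = rescale q (invPochX q r) := by
  have h := prod_mul_invPochX q (r + 1)
  have h' := congrArg (rescale q) (prod_mul_invPochX q r)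
  rw [prod_range_succ', zero_add, pow_one] at h
  rw [map_mul, map_prod, map_one] at h'
  have e : ∀ u, rescale q (1 - C (q ^ (u + 1)) * X) = 1 - C (q ^ (u + 1 + 1)) * X := by
    intro u
    rw [map_sub, map_one, map_mul, rescale_C, rescale_X, ← mul_assoc, ← map_mul, ← pow_succ]
  simp only [e] at h'
  refine mul_left_cancel₀ (a := ∏ u ∈ range r, (1 - C (q ^ (u + 1 + 1)) * X)) ?_ ?_
  · exact prod_ne_zero_iff.2 fun u _ => one_sub_C_mul_X_ne_zero _
  · linear_combination h - h'

/-- `1 / (q;q)_{r-s}`, interpreted as zero for `s > r`. -/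
def kernel (q : K) (r s : ℕ) : K := if s ≤ r then (qPoch q (r - s))⁻¹ else 0

@[simp]
lemma kernel_zero_succ (q : K) (s : ℕ) : kernel q 0 (s + 1) = 0 := by simp [kernel]

@[simp]
lemma kernel_succ_succ (q : K) (r s : ℕ) : kernel q (r + 1) (s + 1) = kernel q r s := by
  simp [kernel]

/-- `1 / ((q;q)_r (qX;q)_r)`. -/
noncomputable def tailSeries (q : K) (r : ℕ) : K⟦X⟧ := C (qPoch q r)⁻¹ * invPochX q r

@[simp]
lemma tailSeries_zero (q : K) : tailSeries q 0 = 1 := by simp [tailSeries]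

lemma tailSeries_succ (q : K) (s : ℕ) : (1 - C q * X) * tailSeries q (s + 1)
    = C (1 - q ^ (s + 1))⁻¹ * rescale q (tailSeries q s) := by
  rw [tailSeries, tailSeries, mul_left_comm, rescale_invPochX, qPoch_succ, map_mul (rescale q),
    ← mul_assoc, mul_inv, map_mul, rescale_C, mul_comm (C _)]

/-- `∑ₛ [r choose s]_q q^{s²} Xˢ / (qX;q)_s = 1 / (qX;q)_r`, divided by `(q;q)_r`. -/
lemma shiftedSum_tailSeries {q : K} (hq : ∀ n : ℕ, q ^ (n + 1) ≠ 1) (r : ℕ) :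
    shiftedSum (fun s => kernel q r s * q ^ (s ^ 2)) (tailSeries q) = tailSeries q r := by
  induction r with
  | zero =>
    ext k
    rw [coeff_shiftedSum _ _ (Nat.lt_succ_self k), sum_range_succ']
    simp [kernel]
  | succ r ih =>
    have hn := qPoch_ne_zero hq
    have h1 : ∀ n, (1 - q ^ (n + 1)) ≠ 0 := fun n => sub_ne_zero.2 (hq n).symm
    -- split according to the `q`-Pascal rule
    have pascal : ∀ s, (1 - q ^ (r + 1)) * kernel q (r + 1) s * (qPoch q s)⁻¹
        = kernel q r s * (qPoch q s)⁻¹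
          + q ^ (r + 1 - s) * (kernel q (r + 1) s * ((1 - q ^ s) * (qPoch q s)⁻¹)) := by
      intro s
      unfold kernel
      rcases lt_trichotomy s (r + 1) with h | h | h
      · obtain ⟨d, rfl⟩ : ∃ d, r = s + d := ⟨r - s, by omega⟩
        rw [if_pos (by omega), if_pos (by omega), show s + d + 1 - s = d + 1 by omega,
          show s + d - s = d by omega, qPoch_succ]
        have := hn d
        have := hn s
        have := h1 d
        field_simp
        ring
      · subst h
        simp
      · rw [if_neg (by omega), if_neg (by omega)]
        simp
    have key : C (1 - q ^ (r + 1)) * shiftedSum (fun s => kernel q (r + 1) s * q ^ (s ^ 2))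
          (tailSeries q)
        = shiftedSum (fun s => kernel q r s * q ^ (s ^ 2)) (tailSeries q)
          + shiftedSum (fun s => q ^ (r + 1 - s) * kernel q (r + 1) s * (1 - q ^ s) * q ^ (s ^ 2))
            (tailSeries q) := by
      rw [show tailSeries q = fun s => C (qPoch q s)⁻¹ * invPochX q s from rfl]
      simp only [shiftedSum_C_mul fun s => (qPoch q s)⁻¹]
      ext k
      simp only [shiftedSum, coeff_C_mul, coeff_mk, map_add, mul_sum, ← sum_add_distrib]
      refine sum_congr rfl fun s _ => ?_
      linear_combination (q ^ (s ^ 2) * coeff (k - s) (invPochX q s)) * pascal s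
    have second : shiftedSum (fun s => q ^ (r + 1 - s) * kernel q (r + 1) s * (1 - q ^ s)
          * q ^ (s ^ 2)) (tailSeries q) * (1 - C q * X)
        = C (q ^ (r + 1)) * X * rescale q (shiftedSum (fun s => kernel q r s * q ^ (s ^ 2))
            (tailSeries q)) := by
      rw [shiftedSum_eq_X_mul (by simp), mul_comm, mul_left_comm, ← shiftedSum_mul_left,
        rescale_shiftedSum, mul_comm (C (q ^ (r + 1))) X, mul_assoc X]
      congr 1
      simp only [tailSeries_succ, shiftedSum_C_mul fun s => (1 - q ^ (s + 1))⁻¹]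
      rw [← shiftedSum_mul_left, shiftedSum_C_mul (fun _ => q ^ (r + 1))]
      ext k
      simp only [shiftedSum, coeff_mk]
      refine sum_congr rfl fun s _ => ?_
      rw [kernel_succ_succ]
      congr 1
      have := h1 s
      by_cases hs : s ≤ r
      · obtain ⟨d, rfl⟩ : ∃ d, r = s + d := ⟨r - s, by omega⟩
        rw [show s + d + 1 - (s + 1) = d by omega]
        field_simp
        ring
      · simp [kernel, hs]
    rw [ih] at key second
    have hC : (C (1 - q ^ (r + 1)) : K⟦X⟧) ≠ 0 := by
      exact fun h => h1 r (by simpa using congrArg constantCoeff h)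
    refine mul_left_cancel₀ hC (mul_right_cancel₀ (one_sub_C_mul_X_ne_zero q) ?_)
    rw [key, add_mul, second, tailSeries, tailSeries, map_mul (rescale q), ← rescale_invPochX,
      ← invPochX_succ, qPoch_succ, mul_inv]
    have e' : (C (1 - q ^ (r + 1)) : K⟦X⟧) * C (1 - q ^ (r + 1))⁻¹ = 1 := by
      rw [← map_mul, mul_inv_cancel₀ (h1 r), map_one]
    rw [rescale_C, map_mul]
    linear_combination (-C (qPoch q r)⁻¹ * invPochX q (r + 1) * (1 - C q * X)) * e'

lemma tailSeries_eq {q : K} (h0 : q ≠ 0) (s : ℕ) :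
    tailSeries q s = X * (C (q ^ s) * tailSeries q s)
      + (1 - X) * rescale q⁻¹ (tailSeries q s) := by
  have h : (1 - C (q ^ (s + 1)) * X) * rescale q (invPochX q s) = (1 - C q * X) * invPochX q s := by
    rw [← rescale_invPochX, ← invPochX_succ q s]
    ring
  have h' := congrArg (rescale q⁻¹) h
  simp only [map_mul, map_sub, map_one, rescale_rescale, mul_inv_cancel₀ h0, rescale_one,
    RingHom.id_apply, rescale_C, rescale_X, ← mul_assoc] at h'
  rw [← map_mul, ← map_mul, mul_inv_cancel₀ h0, pow_succ, mul_assoc, mul_inv_cancel₀ h0, map_one,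
    one_mul, mul_one] at h'
  rw [tailSeries, map_mul, rescale_C]
  linear_combination C (qPoch q s)⁻¹ * h'

/-- For a list `b` of integers, the sum
`∑ u(r₁) q^{∑ₜ rₜ² - rₜ bₜ} X^{∑ₜ rₜ} / ∏ₜ (q;q)_{rₜ - rₜ₊₁}` over descending sequences `r`,
where the rows beyond the length of `b` are already summed up. -/
noncomputable def rowSeries (q : K) : List ℤ → (ℕ → K) → K⟦X⟧
  | [], u => shiftedSum (fun s => u s * q ^ (s ^ 2)) (tailSeries q)
  | b :: bs, u => shiftedSum (fun s => u s * q ^ ((s : ℤ) ^ 2 - s * b))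
      fun s => rowSeries q bs (kernel q s)

section

variable {q : K} (h0 : q ≠ 0) (hq : ∀ n : ℕ, q ^ (n + 1) ≠ 1)

include hq in
lemma rowSeries_singleton (b : ℤ) (u : ℕ → K) :
    rowSeries q [b] u = shiftedSum (fun s => u s * q ^ ((s : ℤ) ^ 2 - s * b)) (tailSeries q) := by
  simp only [rowSeries, shiftedSum_tailSeries hq]

include hq in
lemma rowSeries_append_zero (bs : List ℤ) (u : ℕ → K) :
    rowSeries q (bs ++ [0]) u = rowSeries q bs u := by
  induction bs generalizing u with
  | nil =>
    rw [List.nil_append, rowSeries_singleton hq, rowSeries]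
    congr 1
    ext s
    rw [mul_zero, sub_zero]
    norm_cast
  | cons b bs ih => simp only [List.cons_append, rowSeries, ih]

include h0 hq in
lemma rowSeries_eq_X_mul_add (bs : List ℤ) (b : ℤ) (u : ℕ → K) :
    rowSeries q (bs ++ [b]) u = X * rowSeries q (bs ++ [b - 1]) u
      + (1 - X) * rescale q⁻¹ (rowSeries q ((bs ++ [b]).map (· - 1)) u) := by
  have hpow : ∀ (c : ℤ) (u : ℕ → K), (fun s : ℕ => u s * q ^ ((s : ℤ) ^ 2 - s * (c - 1)) * q⁻¹ ^ s)
      = fun s : ℕ => u s * q ^ ((s : ℤ) ^ 2 - s * c) := by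
    intro c u
    ext s
    rw [mul_assoc, ← zpow_natCast, inv_zpow', ← zpow_add₀ h0]
    congr 2
    ring
  induction bs generalizing u with
  | nil =>
    simp only [List.nil_append, List.map_cons, List.map_nil, rowSeries_singleton hq,
      rescale_shiftedSum]
    rw [hpow, show (fun s : ℕ => u s * q ^ ((s : ℤ) ^ 2 - s * (b - 1)))
        = fun s : ℕ => u s * q ^ ((s : ℤ) ^ 2 - s * b) * q ^ s by
      ext s
      rw [mul_assoc, ← zpow_natCast, ← zpow_add₀ h0]
      congr 2
      ring]
    rw [← shiftedSum_C_mul (fun s => q ^ s), ← shiftedSum_mul_left, ← shiftedSum_mul_left,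
      ← shiftedSum_add]
    congr 1
    ext1 s
    exact tailSeries_eq h0 s
  | cons c bs ih =>
    simp only [List.cons_append, List.map_cons, rowSeries, rescale_shiftedSum]
    rw [hpow, ← shiftedSum_mul_left, ← shiftedSum_mul_left, ← shiftedSum_add]
    congr 1
    ext1 s
    exact ih _

include h0 hq in
lemma one_sub_mul_rowSeries_sub (bs : List ℤ) (b : ℤ) (u : ℕ → K) :
    (1 - C q * X) * (rowSeries q (bs ++ [b]) u - rowSeries q (bs ++ [b - 1]) u)
      = C (q ^ ((bs.length : ℤ) + 1 - (bs.sum + b))) * X ^ (bs.length + 1)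
        * rescale q (rowSeries q ((bs ++ [b]).map (· - 1)) fun s => u (s + 1)) := by
  induction bs generalizing u with
  | nil =>
    simp only [List.nil_append, List.map_cons, List.map_nil, rowSeries_singleton hq,
      rescale_shiftedSum]
    rw [show (fun s : ℕ => u s * q ^ ((s : ℤ) ^ 2 - s * (b - 1)))
        = fun s : ℕ => u s * q ^ ((s : ℤ) ^ 2 - s * b) * q ^ s by
      ext s
      rw [mul_assoc, ← zpow_natCast, ← zpow_add₀ h0]
      congr 2
      ring]
    rw [← shiftedSum_C_mul (fun s => q ^ s), ← shiftedSum_sub, ← shiftedSum_mul_left,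
      shiftedSum_eq_X_mul (by simp), mul_comm (C _) (X ^ _), mul_assoc, C_mul_shiftedSum]
    simp only [List.length_nil, zero_add, pow_one]
    congr 1
    have e : ∀ s, (1 - C q * X) * (tailSeries q (s + 1) - C (q ^ (s + 1)) * tailSeries q (s + 1))
        = rescale q (tailSeries q s) := by
      intro s
      have e' : (C (1 - q ^ (s + 1)) : K⟦X⟧) * C (1 - q ^ (s + 1))⁻¹ = 1 := by
        rw [← map_mul, mul_inv_cancel₀ (sub_ne_zero.2 (hq s).symm), map_one]
      rw [map_sub, map_one] at e'
      linear_combination (1 - C (q ^ (s + 1))) * tailSeries_succ q s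
        + rescale q (tailSeries q s) * e'
    simp only [e]
    congr 1
    ext s
    rw [mul_assoc, mul_left_comm, ← zpow_natCast q s, ← zpow_add₀ h0, ← zpow_add₀ h0]
    congr 2
    push_cast [List.sum_nil]
    ring
  | cons c bs ih =>
    simp only [List.cons_append, List.map_cons, rowSeries, rescale_shiftedSum, List.length_cons,
      List.sum_cons]
    rw [← shiftedSum_sub, ← shiftedSum_mul_left]
    simp only [ih]
    have hz : ∀ l : List ℤ, rowSeries q l (fun _ => 0) = 0 := by
      intro l
      cases l <;> ext k <;> simp [rowSeries, shiftedSum]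
    rw [shiftedSum_mul_left, shiftedSum_eq_X_mul (by simp [hz])]
    simp only [kernel_succ_succ]
    have key : ∀ V : ℕ → K⟦X⟧, C (q ^ ((bs.length : ℤ) + 1 - (bs.sum + b)))
          * shiftedSum (fun s : ℕ => u (s + 1) * q ^ (((s + 1 : ℕ) : ℤ) ^ 2 - (s + 1 : ℕ) * c)) V
        = C (q ^ (((bs.length + 1 : ℕ) : ℤ) + 1 - (c + bs.sum + b)))
          * shiftedSum (fun s : ℕ => u (s + 1) * q ^ ((s : ℤ) ^ 2 - s * (c - 1)) * q ^ s) V := by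
      intro V
      rw [C_mul_shiftedSum, C_mul_shiftedSum]
      congr 1
      ext s
      rw [mul_left_comm, mul_assoc (u _), mul_left_comm _ (u _), ← zpow_natCast q s,
        ← zpow_add₀ h0, ← zpow_add₀ h0, ← zpow_add₀ h0]
      congr 2
      push_cast
      ring
    linear_combination X ^ (bs.length + 2) * key _

end

section

variable {q : K} (h0 : q ≠ 0) (hq : ∀ n : ℕ, q ^ (n + 1) ≠ 1)

/-- `∑ₖ qᵏ Xᵏ / (q;q)_k`, which is `1 / (qX;q)_∞`. -/
noncomputable def eulerSeries (q : K) : K⟦X⟧ := PowerSeries.mk fun k => q ^ k * (qPoch q k)⁻¹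

lemma constantCoeff_rowSeries (bs : List ℤ) {u : ℕ → K} (hu : u 0 = 1) :
    constantCoeff (rowSeries q bs u) = 1 := by
  induction bs generalizing u with
  | nil =>
    rw [← coeff_zero_eq_constantCoeff_apply, rowSeries, shiftedSum, coeff_mk]
    simp [hu]
  | cons b bs ih =>
    have := ih (u := kernel q 0) (by simp [kernel])
    rw [← coeff_zero_eq_constantCoeff_apply] at this
    rw [← coeff_zero_eq_constantCoeff_apply, rowSeries, shiftedSum, coeff_mk]
    rw [sum_range_one, this, hu]
    simp

include h0 hq in
lemma rowSeries_nil : rowSeries q [] (fun _ => 1) = eulerSeries q := by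
  have hS : (1 - C q * X) * rowSeries q [] (fun _ => 1)
      = rescale q (rowSeries q [] fun _ => 1) := by
    have h1 := one_sub_mul_rowSeries_sub h0 hq [] 0 fun _ => 1
    have h2 := congrArg (rescale q) (rowSeries_eq_X_mul_add h0 hq [] 0 fun _ => 1)
    rw [rowSeries_append_zero hq] at h1 h2
    simp only [map_mul, map_add, map_sub, map_one, rescale_rescale, inv_mul_cancel₀ h0, rescale_one,
      RingHom.id_apply, rescale_X, List.nil_append, List.map_cons, List.map_nil, List.length_nil,
      List.sum_nil, Nat.cast_zero, zero_add, sub_zero, zpow_one, pow_one] at h1 h2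
    linear_combination h1 - h2
  ext k
  rw [eulerSeries, coeff_mk]
  induction k with
  | zero =>
    rw [coeff_zero_eq_constantCoeff_apply, constantCoeff_rowSeries _ rfl]
    simp
  | succ k ih =>
    have h := congrArg (coeff (k + 1)) hS
    rw [sub_mul, one_mul, map_sub, mul_assoc, coeff_C_mul, coeff_succ_X_mul, coeff_rescale, ih] at h
    have h1 : 1 - q ^ (k + 1) ≠ 0 := sub_ne_zero.2 (hq k).symm
    have := qPoch_ne_zero hq k
    rw [qPoch_succ]
    refine mul_left_cancel₀ h1 ?_
    rw [show (1 - q ^ (k + 1)) * coeff (k + 1) (rowSeries q [] fun _ => 1)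
      = q * (q ^ k * (qPoch q k)⁻¹) by linear_combination h]
    field_simp
    ring

include hq in
lemma one_sub_mul_eulerSeries : (1 - C q * X) * eulerSeries q = rescale q (eulerSeries q) := by
  ext k
  rw [sub_mul, one_mul, map_sub, mul_assoc, coeff_C_mul, coeff_rescale]
  rcases k with _ | k
  · simp [eulerSeries]
  · rw [coeff_succ_X_mul, eulerSeries, coeff_mk, coeff_mk, qPoch_succ]
    have h1 : 1 - q ^ (k + 1) ≠ 0 := sub_ne_zero.2 (hq k).symm
    have := qPoch_ne_zero hq k
    field_simp
    ring

lemma constantCoeff_eulerSeries : constantCoeff (eulerSeries q) = 1 := by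
  simp [eulerSeries, ← coeff_zero_eq_constantCoeff_apply]

/-- Coefficients of a power series, extended by zero to negative exponents. -/
noncomputable def zcoeff (P : K⟦X⟧) (k : ℤ) : K := if 0 ≤ k then coeff k.toNat P else 0

lemma zcoeff_natCast (P : K⟦X⟧) (k : ℕ) : zcoeff P k = coeff k P := by simp [zcoeff]

lemma zcoeff_of_neg (P : K⟦X⟧) {k : ℤ} (hk : k < 0) : zcoeff P k = 0 := if_neg (not_le.2 hk)

lemma zcoeff_add (P Q : K⟦X⟧) (k : ℤ) : zcoeff (P + Q) k = zcoeff P k + zcoeff Q k := by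
  unfold zcoeff; split_ifs <;> simp

lemma zcoeff_C_mul (a : K) (P : K⟦X⟧) (k : ℤ) : zcoeff (C a * P) k = a * zcoeff P k := by
  unfold zcoeff; split_ifs <;> simp

lemma zcoeff_X_pow_mul (m : ℕ) (P : K⟦X⟧) (k : ℤ) : zcoeff (X ^ m * P) k = zcoeff P (k - m) := by
  rcases le_or_gt (m : ℤ) k with h | h
  · obtain ⟨d, rfl⟩ : ∃ d : ℕ, k = (d + m : ℕ) := ⟨(k - m).toNat, by omega⟩
    rw [zcoeff_natCast, coeff_X_pow_mul, Nat.cast_add, add_sub_cancel_right, zcoeff_natCast]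
  · rw [zcoeff_of_neg P (by omega : k - m < 0), zcoeff]
    split_ifs with h'
    · rw [coeff_X_pow_mul', if_neg (by omega)]
    · rfl

lemma zcoeff_rescale (a : K) (P : K⟦X⟧) (k : ℤ) : zcoeff (rescale a P) k = a ^ k * zcoeff P k := by
  rcases le_or_gt 0 k with h | h
  · obtain ⟨d, rfl⟩ := Int.eq_ofNat_of_zero_le h
    rw [zcoeff_natCast, zcoeff_natCast, coeff_rescale, zpow_natCast]
  · rw [zcoeff_of_neg _ h, zcoeff_of_neg _ h, mul_zero]

include h0 hq in
/-- For a descending list `b` of nonnegative integers, `rowSeries q b 1` times `(qX;q)_∞` is a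
self-reciprocal polynomial of degree `∑ b`. -/
theorem zcoeff_rowSeries_symm (bs : List ℤ) (hs : bs.Pairwise (· ≥ ·)) (hn : ∀ b ∈ bs, 0 ≤ b)
    (k : ℤ) : zcoeff (rowSeries q bs (fun _ => 1) * (eulerSeries q)⁻¹) k
      = zcoeff (rowSeries q bs (fun _ => 1) * (eulerSeries q)⁻¹) (bs.sum - k) := by
  have he : eulerSeries q * (eulerSeries q)⁻¹ = 1 :=
    PowerSeries.mul_inv_cancel _ (by rw [constantCoeff_eulerSeries]; exact one_ne_zero)
  induction hN : bs.sum.toNat + bs.length using Nat.strong_induction_on generalizing bs k with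
  | _ N ih =>
    rcases List.eq_nil_or_concat' bs with rfl | ⟨cs, b, rfl⟩
    · rw [rowSeries_nil h0 hq, he]
      unfold zcoeff
      rcases lt_trichotomy k 0 with h | rfl | h
      · have h' : (-k).toNat ≠ 0 := by omega
        simp [coeff_one, h.not_ge, h.le, h']
      · simp
      · have h' : k.toNat ≠ 0 := by omega
        simp [coeff_one, h.not_ge, h.le, h']
    have hsum : 0 ≤ cs.sum := List.sum_nonneg fun c hc => hn c (by simp [hc])
    obtain ⟨hcs, -, hcb⟩ := List.pairwise_append.1 hs
    replace hcb : ∀ c ∈ cs, b ≤ c := fun c hc => hcb c hc b (by simp)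
    have hb : 0 ≤ b := hn b (by simp)
    rcases hb.eq_or_lt with rfl | hb
    · rw [rowSeries_append_zero hq, List.sum_append, List.sum_singleton, add_zero]
      exact ih _ (by rw [← hN]; simp) cs hcs (fun c hc => hn c (by simp [hc])) k rfl
    have hmap : ((cs ++ [b]).map (· - 1)).sum = cs.sum + b - (cs.length + 1) := by
      have : ∀ l : List ℤ, (l.map (· - 1)).sum = l.sum - l.length := by
        intro l
        induction l with
        | nil => simp
        | cons a l ih => simp [ih]; ring
      rw [this]
      simp
    have hle : (cs.length : ℤ) ≤ cs.sum := by
      have : ∀ l : List ℤ, (∀ c ∈ l, 1 ≤ c) → (l.length : ℤ) ≤ l.sum := by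
        intro l
        induction l with
        | nil => simp
        | cons a l ih =>
          intro h
          have h1 := h a (by simp)
          have h2 := ih fun c hc => h c (by simp [hc])
          simp only [List.length_cons, List.sum_cons]
          push_cast
          omega
      exact this cs fun c hc => by have := hcb c hc; omega
    have hx := ih ((cs ++ [b - 1]).sum.toNat + (cs ++ [b - 1]).length)
      (by rw [← hN]; simp only [List.sum_append, List.sum_singleton, List.length_append,
            List.length_singleton]; omega) (cs ++ [b - 1])
      (List.pairwise_append.2 ⟨hcs, by simp, fun c hc d hd => by
        have := hcb c hc; simp only [List.mem_singleton] at hd; omega⟩)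
      (fun c hc => by
        rcases List.mem_append.1 hc with h | h
        · exact hn c (by simp [h])
        · simp only [List.mem_singleton] at h; omega)
    have hw := ih (((cs ++ [b]).map (· - 1)).sum.toNat + ((cs ++ [b]).map (· - 1)).length)
      (by rw [← hN, hmap, List.length_map]; simp only [List.sum_append, List.sum_singleton,
            List.length_append, List.length_singleton]; omega) ((cs ++ [b]).map (· - 1))
      (List.pairwise_map.2 (hs.imp fun h => by omega))
      (fun c hc => by
        obtain ⟨d, hd, rfl⟩ := List.mem_map.1 hc
        rcases List.mem_append.1 hd with h | h
        · have := hcb d h; omega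
        · simp only [List.mem_singleton] at h; omega)
    have hI := one_sub_mul_rowSeries_sub h0 hq cs b fun _ => 1
    have hII := rowSeries_eq_X_mul_add h0 hq cs b fun _ => 1
    rw [hmap] at hw
    generalize rowSeries q ((cs ++ [b]).map (· - 1)) (fun _ => 1) = w at *
    generalize rowSeries q (cs ++ [b - 1]) (fun _ => 1) = x at *
    generalize rowSeries q (cs ++ [b]) (fun _ => 1) = p at *
    set e := eulerSeries q with hedef
    have hE : (1 - C q * X) * e = rescale q e := one_sub_mul_eulerSeries hq
    have hE' : e = (1 - X) * rescale q⁻¹ e := by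
      have := congrArg (rescale q⁻¹) hE
      rwa [map_mul, rescale_rescale, mul_inv_cancel₀ h0, rescale_one, RingHom.id_apply, map_sub,
        map_one, map_mul, rescale_C, rescale_X, ← mul_assoc, ← map_mul, mul_inv_cancel₀ h0, map_one,
        one_mul, eq_comm] at this
    have hinv : ∀ a, rescale a e * rescale a e⁻¹ = 1 := fun a => by rw [← map_mul, he, map_one]
    have h1 : p * e⁻¹ = x * e⁻¹ + C (q ^ ((cs.length : ℤ) + 1 - (cs.sum + b)))
        * (X ^ (cs.length + 1) * rescale q (w * e⁻¹)) := by
      refine mul_left_cancel₀ (one_sub_C_mul_X_ne_zero q) ?_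
      rw [map_mul]
      linear_combination e⁻¹ * hI - C (q ^ ((cs.length : ℤ) + 1 - (cs.sum + b)))
        * X ^ (cs.length + 1) * rescale q w * e⁻¹ * (hinv q)
        + C (q ^ ((cs.length : ℤ) + 1 - (cs.sum + b)))
          * X ^ (cs.length + 1) * rescale q w * rescale q e⁻¹ * ((1 - C q * X) * he - e⁻¹ * hE)
    have h2 : p * e⁻¹ = X ^ 1 * (x * e⁻¹) + rescale q⁻¹ (w * e⁻¹) := by
      rw [map_mul]
      linear_combination e⁻¹ * hII - (1 - X) * rescale q⁻¹ w * e⁻¹ * hinv q⁻¹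
        + rescale q⁻¹ w * rescale q⁻¹ e⁻¹ * (he - e⁻¹ * hE')
    have h3 := congrArg (zcoeff · k) h1
    have h4 := congrArg (zcoeff · ((cs ++ [b]).sum - k)) h2
    simp only [zcoeff_add, zcoeff_C_mul, zcoeff_X_pow_mul, zcoeff_rescale] at h3 h4
    rw [h3, h4, hx k rfl, hw _ rfl, ← mul_assoc, ← zpow_add₀ h0, inv_zpow']
    simp only [List.sum_append, List.sum_singleton]
    congr 2
    · push_cast; ring
    · congr 1; push_cast; ring
    · congr 1; push_cast; ring

end

end QSeries

@[to_additive]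
lemma finprod_nat_eq_mul {M : Type*} [CommMonoid M] (f : ℕ → M)
    (hf : (Function.mulSupport f).Finite) : ∏ᶠ t, f t = f 0 * ∏ᶠ t, f (t + 1) := by
  obtain ⟨N, hN⟩ := hf.bddAbove
  have h : ∀ t, N < t → f t = 1 := fun t ht => by
    by_contra h
    exact absurd (hN h) (not_le.2 ht)
  rw [finprod_eq_prod_of_mulSupport_subset f (s := Finset.range (N + 2)),
    finprod_eq_prod_of_mulSupport_subset (fun t => f (t + 1)) (s := Finset.range (N + 1)),
    Finset.prod_range_succ', mul_comm]
  · intro t ht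
    by_contra h'
    exact ht (h _ (by simp at h'; omega))
  · intro t ht
    by_contra h'
    exact ht (h _ (by simp at h'; omega))

namespace IsDescending

lemma eq_zero_of_zero {s : ℕ → ℕ} (h : IsDescending s) (h0 : s 0 = 0) : s = 0 := by
  ext t
  simpa [h0] using h.1 (Nat.zero_le t)

lemma finite_support {M : Type*} [Zero M] {s : ℕ → ℕ} (h : IsDescending s) (f : ℕ → M)
    (hf : ∀ t, s t = 0 → f t = 0) : (Function.support f).Finite := by
  obtain ⟨N, hN⟩ := h.2
  refine (Set.finite_lt_nat N).subset fun t ht => ?_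
  by_contra h'
  exact ht (hf t (hN t (not_lt.1 h')))

lemma finite_mulSupport {M : Type*} [One M] {s : ℕ → ℕ} (h : IsDescending s) (f : ℕ → M)
    (hf : ∀ t, s t = 0 → f t = 1) : (Function.mulSupport f).Finite := by
  obtain ⟨N, hN⟩ := h.2
  refine (Set.finite_lt_nat N).subset fun t ht => ?_
  by_contra h'
  exact ht (hf t (hN t (not_lt.1 h')))

lemma tail {s : ℕ → ℕ} (h : IsDescending s) : IsDescending fun t => s (t + 1) := by
  obtain ⟨N, hN⟩ := h.2
  exact ⟨fun a b hab => h.1 (by omega), N, fun t ht => hN _ (by omega)⟩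

lemma zero : IsDescending 0 := ⟨fun _ _ _ => le_rfl, 0, fun _ _ => rfl⟩

/-- Prepend an entry to a sequence. -/
def cons (a : ℕ) (s : ℕ → ℕ) : ℕ → ℕ
  | 0 => a
  | t + 1 => s t

lemma isDescending_cons {a : ℕ} {s : ℕ → ℕ} (h : IsDescending s) (ha : s 0 ≤ a) :
    IsDescending (cons a s) := by
  obtain ⟨N, hN⟩ := h.2
  refine ⟨antitone_nat_of_succ_le fun t => ?_, N + 1, fun t ht => ?_⟩
  · cases t with
    | zero => exact ha
    | succ t => exact h.1 t.le_succ
  · obtain ⟨t, rfl⟩ : ∃ u, t = u + 1 := ⟨t - 1, by omega⟩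
    exact hN t (by omega)

lemma finsum_eq {s : ℕ → ℕ} (h : IsDescending s) : ∑ᶠ t, s t = s 0 + ∑ᶠ t, s (t + 1) :=
  finsum_nat_eq_add s (h.finite_support s fun _ => id)

lemma apply_le_finsum {s : ℕ → ℕ} (h : IsDescending s) (t : ℕ) : s t ≤ ∑ᶠ t, s t :=
  single_le_finsum t (h.finite_support s fun _ => id) fun _ => Nat.zero_le _

lemma finite_setOf_finsum_eq (k : ℕ) : {s : ℕ → ℕ | IsDescending s ∧ ∑ᶠ t, s t = k}.Finite := by
  have hsum : ∀ N, ∀ s : ℕ → ℕ, IsDescending s → ∑ᶠ t, s t ≤ N → s N = 0 := by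
    intro N
    induction N with
    | zero =>
      intro s hs h
      have := hs.apply_le_finsum 0
      omega
    | succ N ih =>
      intro s hs h
      by_cases h0 : s 0 = 0
      · rw [hs.eq_zero_of_zero h0]; rfl
      · refine ih _ hs.tail ?_
        rw [hs.finsum_eq] at h
        omega
  refine ((Set.finite_Iic (∑ t ∈ Finset.range k, Finsupp.single t k)).image
    fun f : ℕ →₀ ℕ => (f : ℕ → ℕ)).subset ?_
  rintro s ⟨hs, hk⟩
  have hz : ∀ t, k ≤ t → s t = 0 := fun t ht =>
    Nat.le_zero.1 ((hs.1 ht).trans (hsum k s hs hk.le).le)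
  refine ⟨Finsupp.ofSupportFinite s (hs.finite_support s fun _ => id), fun t => ?_, rfl⟩
  rw [Finsupp.finsetSum_apply, Finsupp.ofSupportFinite_coe]
  simp only [Finsupp.single_apply, Finset.sum_ite_eq', Finset.mem_range]
  split_ifs with h
  · exact hk ▸ hs.apply_le_finsum t
  · exact (hz t (not_lt.1 h)).le

/-- The descending sequences with sum `k`. -/
noncomputable def withSum (k : ℕ) : Finset (ℕ → ℕ) := (finite_setOf_finsum_eq k).toFinset

lemma mem_withSum {k : ℕ} {s : ℕ → ℕ} : s ∈ withSum k ↔ IsDescending s ∧ ∑ᶠ t, s t = k := by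
  simp [withSum]

lemma withSum_zero : withSum 0 = {0} := by
  ext s
  rw [mem_withSum, Finset.mem_singleton]
  constructor
  · rintro ⟨hs, h⟩
    exact hs.eq_zero_of_zero (Nat.le_zero.1 (h ▸ hs.apply_le_finsum 0))
  · rintro rfl
    exact ⟨zero, by simp⟩

lemma sum_withSum {M : Type*} [AddCommMonoid M] (k : ℕ) (f : (ℕ → ℕ) → M) :
    ∑ s ∈ withSum k, f s
      = ∑ a ∈ Finset.range (k + 1), ∑ s ∈ withSum (k - a) with s 0 ≤ a, f (cons a s) := by
  rw [Finset.sum_sigma']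
  refine Finset.sum_nbij' (fun s => ⟨s 0, fun t => s (t + 1)⟩) (fun p => cons p.1 p.2) ?_ ?_ ?_ ?_ ?_
  · intro s hs
    obtain ⟨hs, h⟩ := mem_withSum.1 hs
    rw [hs.finsum_eq] at h
    simp only [Finset.mem_sigma, Finset.mem_range, Finset.mem_filter, mem_withSum]
    exact ⟨by omega, ⟨hs.tail, by omega⟩, hs.1 (Nat.zero_le _)⟩
  · rintro ⟨a, s⟩ hp
    simp only [Finset.mem_sigma, Finset.mem_range, Finset.mem_filter, mem_withSum] at hp ⊢
    obtain ⟨ha, ⟨hs, h⟩, hle⟩ := hp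
    refine ⟨isDescending_cons hs hle, ?_⟩
    rw [(isDescending_cons hs hle).finsum_eq]
    change a + ∑ᶠ t, s t = k
    omega
  · intro s _
    ext t
    cases t <;> rfl
  · intro p _
    rfl
  · intro s _
    congr 1
    ext t
    cases t <;> rfl

end IsDescending

namespace QSeries

open PowerSeries Finset

variable {K : Type*} [Field K]

/-- The product `∏ⱼ (q;q)_{s⁽ʲ⁾ - s⁽ʲ⁺¹⁾}⁻¹`. -/
noncomputable def invAut (q : K) (s : ℕ → ℕ) : K := ∏ᶠ t, (qPoch q (s t - s (t + 1)))⁻¹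

/-- The exponent `∑ₜ sₜ² - sₜ bₜ`. -/
noncomputable def rowExp (b : ℕ → ℤ) (s : ℕ → ℕ) : ℤ := ∑ᶠ t, ((s t : ℤ) ^ 2 - s t * b t)

/-- The series `∑ u(s₁) q^{∑ₜ sₜ² - sₜ bₜ} X^{|s|} / ∏ₜ (q;q)_{sₜ - sₜ₊₁}` over descending `s`. -/
noncomputable def rowSum (q : K) (b : ℕ → ℤ) (u : ℕ → K) : K⟦X⟧ :=
  PowerSeries.mk fun k => ∑ s ∈ IsDescending.withSum k, u (s 0) * (q ^ rowExp b s * invAut q s)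

lemma invAut_cons (q : K) (a : ℕ) {s : ℕ → ℕ} (hs : IsDescending s) (ha : s 0 ≤ a) :
    invAut q (IsDescending.cons a s) = (qPoch q (a - s 0))⁻¹ * invAut q s :=
  have h := IsDescending.isDescending_cons hs ha
  finprod_nat_eq_mul _ (h.finite_mulSupport _ fun t ht => by
    rw [ht, Nat.zero_sub, qPoch_zero, inv_one])

lemma rowExp_cons (b : ℕ → ℤ) (a : ℕ) {s : ℕ → ℕ} (hs : IsDescending s) (ha : s 0 ≤ a) :
    rowExp b (IsDescending.cons a s) = ((a : ℤ) ^ 2 - a * b 0) + rowExp (fun t => b (t + 1)) s :=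
  have h := IsDescending.isDescending_cons hs ha
  finsum_nat_eq_add _ (h.finite_support _ fun t ht => by simp [ht])

lemma rowSum_eq {q : K} (h0 : q ≠ 0) (b : ℕ → ℤ) (u : ℕ → K) :
    rowSum q b u = shiftedSum (fun s => u s * q ^ ((s : ℤ) ^ 2 - s * b 0))
      fun s => rowSum q (fun t => b (t + 1)) (kernel q s) := by
  ext k
  rw [rowSum, coeff_mk, IsDescending.sum_withSum, shiftedSum, coeff_mk]
  refine sum_congr rfl fun a _ => ?_
  rw [rowSum, coeff_mk, mul_sum, sum_filter]
  refine sum_congr rfl fun s hs => ?_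
  have hs' := (IsDescending.mem_withSum.1 hs).1
  unfold kernel
  split_ifs with h
  · rw [rowExp_cons b a hs' h, invAut_cons q a hs' h, zpow_add₀ h0]
    change u a * _ = _
    ring
  · simp

lemma rowSum_zero_kernel {q : K} (h0 : q ≠ 0) (hq : ∀ n : ℕ, q ^ (n + 1) ≠ 1) (r : ℕ) :
    rowSum q 0 (kernel q r) = tailSeries q r := by
  ext k
  induction k using Nat.strong_induction_on generalizing r with
  | _ k ih =>
    rw [rowSum_eq h0, ← shiftedSum_tailSeries hq, shiftedSum, shiftedSum, coeff_mk, coeff_mk]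
    refine sum_congr rfl fun s hs => ?_
    have e : q ^ ((s : ℤ) ^ 2 - s * (0 : ℕ → ℤ) 0) = q ^ (s ^ 2) := by
      simp only [Pi.zero_apply, mul_zero, sub_zero]
      norm_cast
    rw [e]
    congr 1
    change coeff (k - s) (rowSum q 0 (kernel q s)) = _
    rcases Nat.eq_zero_or_pos s with rfl | hs0
    · rw [tailSeries_zero, Nat.sub_zero, rowSum, coeff_mk]
      rcases Nat.eq_zero_or_pos k with rfl | hk
      · simp [IsDescending.withSum_zero, kernel, invAut, rowExp]
      · rw [coeff_one, if_neg hk.ne']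
        refine sum_eq_zero fun s hs => ?_
        obtain ⟨hs, h⟩ := IsDescending.mem_withSum.1 hs
        have : s 0 ≠ 0 := fun h' => by
          rw [hs.eq_zero_of_zero h'] at h
          simp at h
          omega
        simp [kernel, this]
    · exact ih (k - s) (by have := mem_range.1 hs; omega) s

lemma rowSum_eq_rowSeries {q : K} (h0 : q ≠ 0) (hq : ∀ n : ℕ, q ^ (n + 1) ≠ 1) (N : ℕ)
    (b : ℕ → ℤ) (hb : ∀ t, N ≤ t → b t = 0) (u : ℕ → K) :
    rowSum q b u = rowSeries q ((List.range N).map b) u := by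
  induction N generalizing b u with
  | zero =>
    obtain rfl : b = 0 := funext fun t => hb t (Nat.zero_le t)
    rw [rowSum_eq h0, List.range_zero, List.map_nil, rowSeries]
    have : ∀ s, rowSum q (fun t => (0 : ℕ → ℤ) (t + 1)) (kernel q s) = tailSeries q s :=
      rowSum_zero_kernel h0 hq
    simp only [this]
    congr 1
    ext s
    simp only [Pi.zero_apply, mul_zero, sub_zero]
    norm_cast
  | succ N ih =>
    rw [rowSum_eq h0, List.range_succ_eq_map, List.map_cons, rowSeries, List.map_map]
    congr 1
    ext1 s
    exact ih (fun t => b (t + 1)) (fun t ht => hb _ (by omega)) _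

/-- The series `rowSum q b 1` divided by `1 / (qX;q)_∞`. -/
noncomputable def rowPoly (q : K) (b : ℕ → ℤ) : K⟦X⟧ :=
  rowSum q b (fun _ => 1) * (eulerSeries q)⁻¹

lemma rowPoly_mul (q : K) (b : ℕ → ℤ) :
    rowPoly q b * eulerSeries q = rowSum q b fun _ => 1 := by
  rw [rowPoly, mul_assoc, PowerSeries.inv_mul_cancel _
    (by rw [constantCoeff_eulerSeries]; exact one_ne_zero), mul_one]

theorem zcoeff_rowPoly_symm {q : K} (h0 : q ≠ 0) (hq : ∀ n : ℕ, q ^ (n + 1) ≠ 1) {b : ℕ → ℕ}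
    (hb : IsDescending b) (k : ℤ) :
    zcoeff (rowPoly q fun t => (b t : ℤ)) k
      = zcoeff (rowPoly q fun t => (b t : ℤ)) (((∑ᶠ t, b t : ℕ) : ℤ) - k) := by
  obtain ⟨N, hN⟩ := hb.2
  have hsum : ((∑ᶠ t, b t : ℕ) : ℤ) = ((List.range N).map fun t => (b t : ℤ)).sum := by
    rw [finsum_eq_sum_of_support_subset (s := range N) b]
    · rw [Nat.cast_sum]
      rfl
    · intro t ht
      by_contra h
      exact ht (hN t (by simpa using h))
  rw [hsum, rowPoly, rowSum_eq_rowSeries h0 hq N _ fun t ht => by rw [hN t ht, Nat.cast_zero]]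
  refine zcoeff_rowSeries_symm h0 hq _ ?_ ?_ k
  · refine List.pairwise_map.2 (List.pairwise_lt_range.imp fun h => ?_)
    exact_mod_cast hb.1 h.le
  · intro c hc
    obtain ⟨t, -, rfl⟩ := List.mem_map.1 hc
    exact Int.natCast_nonneg _

end QSeries

/-- The bilinear form `cᵀ A d`. -/
def bilForm {ι : Type*} [Fintype ι] (A : Matrix ι ι ℤ) (c d : ι → ℤ) : ℤ :=
  ∑ i, ∑ j, c i * A i j * d j

namespace bilForm

variable {ι : Type*} [Fintype ι] {A : Matrix ι ι ℤ}

lemma add_left (c c' d : ι → ℤ) : bilForm A (c + c') d = bilForm A c d + bilForm A c' d := by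
  simp [bilForm, add_mul, Finset.sum_add_distrib]

lemma smul_left (x : ℤ) (c d : ι → ℤ) : bilForm A (x • c) d = x * bilForm A c d := by
  simp [bilForm, Finset.mul_sum, mul_assoc]

lemma comm (hA : A.IsSymm) (c d : ι → ℤ) : bilForm A c d = bilForm A d c := by
  rw [bilForm, bilForm, Finset.sum_comm]
  refine Finset.sum_congr rfl fun i _ => Finset.sum_congr rfl fun j _ => ?_
  rw [hA.apply]
  ring

lemma add_right (hA : A.IsSymm) (c d d' : ι → ℤ) :
    bilForm A c (d + d') = bilForm A c d + bilForm A c d' := by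
  rw [comm hA, add_left, comm hA d, comm hA d']

lemma smul_right (hA : A.IsSymm) (x : ℤ) (c d : ι → ℤ) :
    bilForm A c (x • d) = x * bilForm A c d := by
  rw [comm hA, smul_left, comm hA]

lemma single_left [DecidableEq ι] (i : ι) (d : ι → ℤ) :
    bilForm A (Pi.single i 1) d = ∑ j, A i j * d j := by
  rw [bilForm, Finset.sum_eq_single i]
  · simp
  · intro j _ h
    simp [h]
  · simp

lemma single_single [DecidableEq ι] (i : ι) :
    bilForm A (Pi.single i 1) (Pi.single i 1) = A i i := by
  rw [single_left, Finset.sum_eq_single i] <;> simp +contextual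

lemma add_smul_single [DecidableEq ι] (hA : A.IsSymm) (hdiag : ∀ i, A i i = 2) (c : ι → ℤ) (i : ι)
    (x : ℤ) :
    bilForm A (c + x • Pi.single i 1) (c + x • Pi.single i 1)
      = bilForm A c c + 2 * (x ^ 2 + x * ∑ j, A i j * c j) := by
  rw [add_left, add_right hA, add_right hA, smul_left, smul_right hA, smul_left, smul_right hA,
    single_single, comm hA c (Pi.single i 1), single_left, hdiag]
  ring

end bilForm

namespace QSeries

open Finset

variable {ι : Type*} [Fintype ι]

/-- The tuples of descending sequences with prescribed sums. -/
noncomputable def rows [DecidableEq ι] (c : ι → ℕ) : Finset (ι → ℕ → ℕ) :=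
  Fintype.piFinset fun i => IsDescending.withSum (c i)

lemma mem_rows [DecidableEq ι] {c : ι → ℕ} {r : ι → ℕ → ℕ} :
    r ∈ rows c ↔ (∀ i, IsDescending (r i)) ∧ ∀ i, ∑ᶠ t, r i t = c i := by
  simp [rows, IsDescending.mem_withSum, forall_and]

/-- The weighted sum `∑ⱼ (-Aᵢⱼ) rⱼ` over the neighbours `j` of `i`. -/
def nbrSum (A : Matrix ι ι ℤ) (i : ι) (r : ι → ℕ → ℕ) (t : ℕ) : ℕ :=
  ∑ j, (-A i j).toNat * r j t

lemma finite_support_of_forall_isDescending {r : ι → ℕ → ℕ} (hr : ∀ i, IsDescending (r i))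
    {M : Type*} [Zero M] (f : ℕ → M) (hf : ∀ t, (∀ i, r i t = 0) → f t = 0) :
    (Function.support f).Finite := by
  refine (Set.finite_iUnion fun i => (hr i).finite_support (r i) fun _ => id).subset
    fun t ht => ?_
  by_contra h
  exact ht (hf t fun i => by simpa using fun h' => h (Set.mem_iUnion.2 ⟨i, h'⟩))

lemma isDescending_nbrSum (A : Matrix ι ι ℤ) (i : ι) {r : ι → ℕ → ℕ}
    (hr : ∀ i, IsDescending (r i)) : IsDescending (nbrSum A i r) := by
  refine ⟨fun a b hab => sum_le_sum fun j _ => Nat.mul_le_mul_left _ ((hr j).1 hab), ?_⟩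
  obtain ⟨N, hN⟩ := (finite_support_of_forall_isDescending hr (nbrSum A i r)
    fun t ht => by simp [nbrSum, ht]).bddAbove
  refine ⟨N + 1, fun t ht => ?_⟩
  by_contra h
  have := hN h
  omega

lemma finsum_nbrSum (A : Matrix ι ι ℤ) (i : ι) {r : ι → ℕ → ℕ} (hr : ∀ i, IsDescending (r i)) :
    ∑ᶠ t, nbrSum A i r t = ∑ j, (-A i j).toNat * ∑ᶠ t, r j t := by
  have h : ∀ j, (Function.support (r j)).Finite := fun j => (hr j).finite_support _ fun _ => id
  simp only [nbrSum]
  rw [finsum_sum_comm _ _ fun j _ => (hr j).finite_support _ fun t ht => by rw [ht, mul_zero]]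
  exact sum_congr rfl fun j _ => (mul_finsum' _ _ (h j)).symm

lemma natCast_toNat_neg {ι : Type*} {A : Matrix ι ι ℤ}
    (hoff : ∀ i j, i ≠ j → A i j = 0 ∨ A i j = -1) {i j : ι} (h : i ≠ j) :
    ((-A i j).toNat : ℤ) = -A i j := by
  rcases hoff i j h with h | h <;> simp [h]

section Exponent

variable {A : Matrix ι ι ℤ} (hA : A.IsSymm) (hdiag : ∀ i, A i i = 2)
  (hoff : ∀ i j, i ≠ j → A i j = 0 ∨ A i j = -1) {E : (ι → ℕ → ℕ) → ℤ}
  (hE : ∀ r, 2 * E r = ∑ᶠ t : ℕ, bilForm A (fun i => (r i t : ℤ)) fun i => (r i t : ℤ))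

include hdiag hoff in
lemma sum_mul_eq (i : ι) (c : ι → ℤ) :
    ∑ j, A i j * c j = 2 * c i - ∑ j, ((-A i j).toNat : ℤ) * c j := by
  rw [eq_sub_iff_add_eq, ← sum_add_distrib, sum_eq_single i]
  · simp [hdiag]
  · intro j _ h
    rw [natCast_toNat_neg hoff h.symm]
    ring
  · simp

variable [DecidableEq ι]

include hA hdiag hoff hE in
lemma exponent_eq_add (i : ι) {r : ι → ℕ → ℕ} (hr : ∀ i, IsDescending (r i)) :
    E r = E (Function.update r i 0)
      + rowExp (fun t => (nbrSum A i (Function.update r i 0) t : ℤ)) (r i) := by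
  have hr' : ∀ j, IsDescending (Function.update r i 0 j) := by
    intro j
    rcases eq_or_ne j i with rfl | h
    · simpa using IsDescending.zero
    · simpa [h] using hr j
  have key : ∀ t, bilForm A (fun j => (r j t : ℤ)) (fun j => (r j t : ℤ))
      = bilForm A (fun j => (Function.update r i 0 j t : ℤ))
          (fun j => (Function.update r i 0 j t : ℤ))
        + 2 * ((r i t : ℤ) ^ 2 - r i t * (nbrSum A i (Function.update r i 0) t : ℤ)) := by
    intro t
    have h : (fun j => (r j t : ℤ))
        = (fun j => (Function.update r i 0 j t : ℤ)) + (r i t : ℤ) • Pi.single i 1 := by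
      ext j
      rcases eq_or_ne j i with rfl | h <;> simp [*]
    rw [h, bilForm.add_smul_single hA hdiag, sum_mul_eq hdiag hoff]
    simp [nbrSum]
    ring
  have := hE r
  simp only [key] at this
  rw [finsum_add_distrib, ← mul_finsum, ← hE, ← rowExp] at this
  · omega
  · exact finite_support_of_forall_isDescending hr' _ fun t ht => by simp [ht, bilForm]
  · exact (hr i).finite_support _ fun t ht => by simp [ht]

end Exponent

variable [DecidableEq ι] {K : Type*} [Field K]

/-- The weight `q^{E r} ∏ᵢ ∏ⱼ (q;q)_{rᵢ⁽ʲ⁾ - rᵢ⁽ʲ⁺¹⁾}⁻¹` of a tuple of descending sequences. -/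
noncomputable def weight (q : K) (E : (ι → ℕ → ℕ) → ℤ) (r : ι → ℕ → ℕ) : K :=
  q ^ E r * ∏ i, invAut q (r i)

/-- The generating function of tuples of descending sequences. -/
noncomputable def tupleSeries (q : K) (E : (ι → ℕ → ℕ) → ℤ) : MvPowerSeries ι K :=
  fun c => ∑ r ∈ rows c, weight q E r

/-- The generating function of tuples of descending sequences, divided by `1 / (q yᵢ;q)_∞`. -/
noncomputable def redTupleSeries (q : K) (A : Matrix ι ι ℤ) (E : (ι → ℕ → ℕ) → ℤ) (i : ι) :
    MvPowerSeries ι K :=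
  fun c => ∑ r ∈ rows (Function.update c i 0),
    weight q E r * PowerSeries.coeff (c i) (rowPoly q fun t => (nbrSum A i r t : ℤ))

@[simp]
lemma invAut_zero (q : K) : invAut q 0 = 1 := by simp [invAut]

lemma sum_rows (c : ι → ℕ) (i : ι) {M : Type*} [AddCommMonoid M] (f : (ι → ℕ → ℕ) → M) :
    ∑ r ∈ rows c, f r = ∑ r ∈ rows (Function.update c i 0),
      ∑ s ∈ IsDescending.withSum (c i), f (Function.update r i s) := by
  rw [← sum_product']
  refine sum_nbij' (fun r => (Function.update r i 0, r i)) (fun p => Function.update p.1 i p.2)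
    ?_ ?_ ?_ ?_ ?_
  · intro r hr
    simp only [rows, Fintype.mem_piFinset, mem_product] at hr ⊢
    refine ⟨fun j => ?_, hr i⟩
    rcases eq_or_ne j i with rfl | h
    · simp [IsDescending.withSum_zero]
    · simpa [h] using hr j
  · rintro ⟨r, s⟩ hp
    simp only [rows, Fintype.mem_piFinset, mem_product] at hp ⊢
    intro j
    rcases eq_or_ne j i with rfl | h
    · simpa using hp.2
    · simpa [h] using hp.1 j
  · intro r _
    simp
  · rintro ⟨r, s⟩ hp
    simp only [rows, Fintype.mem_piFinset, mem_product] at hp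
    have := hp.1 i
    simp only [Function.update_self, IsDescending.withSum_zero, mem_singleton] at this
    simp [← this]
  · intro r _
    simp

lemma eq_zero_of_mem_rows_update {c : ι → ℕ} {i : ι} {r : ι → ℕ → ℕ}
    (hr : r ∈ rows (Function.update c i 0)) : r i = 0 := by
  simpa [IsDescending.withSum_zero] using Fintype.mem_piFinset.1 hr i

lemma coeff_tupleSeries {q : K} (h0 : q ≠ 0) {A : Matrix ι ι ℤ} (hA : A.IsSymm)
    (hdiag : ∀ i, A i i = 2) (hoff : ∀ i j, i ≠ j → A i j = 0 ∨ A i j = -1)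
    {E : (ι → ℕ → ℕ) → ℤ}
    (hE : ∀ r, 2 * E r = ∑ᶠ t : ℕ, bilForm A (fun i => (r i t : ℤ)) fun i => (r i t : ℤ))
    (i : ι) (c : ι →₀ ℕ) :
    MvPowerSeries.coeff c (tupleSeries q E) = ∑ r ∈ rows (Function.update c i 0), weight q E r *
      PowerSeries.coeff (c i) (rowSum q (fun t => (nbrSum A i r t : ℤ)) fun _ => 1) := by
  change ∑ r ∈ rows c, weight q E r = _
  rw [sum_rows _ i]
  refine sum_congr rfl fun r hr => ?_
  rw [rowSum, PowerSeries.coeff_mk, mul_sum]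
  refine sum_congr rfl fun s hs => ?_
  have hri := eq_zero_of_mem_rows_update hr
  have hup : Function.update r i 0 = r := by rw [← hri, Function.update_eq_self]
  have hd : ∀ j, IsDescending (Function.update r i s j) := by
    intro j
    rcases eq_or_ne j i with rfl | h
    · simpa using (IsDescending.mem_withSum.1 hs).1
    · simpa [h] using (mem_rows.1 hr).1 j
  rw [weight, exponent_eq_add hA hdiag hoff hE i hd, zpow_add₀ h0, Function.update_idem, hup,
    Function.update_self, weight, ← mul_prod_erase univ _ (mem_univ i),
    ← mul_prod_erase univ (fun j => invAut q (r j)) (mem_univ i), hri, invAut_zero,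
    Function.update_self, prod_congr rfl fun j hj => by
      rw [Function.update_of_ne (ne_of_mem_erase hj)]]
  ring

end QSeries

namespace QSeries

open Finset

variable {ι : Type*} [Fintype ι] {K : Type*} [CommRing K]

/-- The coefficients of a power series, extended by zero to integer exponents. -/
noncomputable def intCoeff (B : MvPowerSeries ι K) (c : ι → ℤ) : K :=
  open Classical in
  if 0 ≤ c then MvPowerSeries.coeff (Finsupp.equivFunOnFinite.symm fun i => (c i).toNat) B else 0

lemma intCoeff_natCast (B : MvPowerSeries ι K) (c : ι →₀ ℕ) :
    intCoeff B (fun i => (c i : ℤ)) = MvPowerSeries.coeff c B := by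
  have h : (0 : ι → ℤ) ≤ fun i => (c i : ℤ) := fun i => Int.natCast_nonneg _
  rw [intCoeff, if_pos h]
  congr 2
  ext i
  simp

lemma intCoeff_of_not_nonneg (B : MvPowerSeries ι K) {c : ι → ℤ} (hc : ¬ 0 ≤ c) :
    intCoeff B c = 0 := if_neg hc

lemma exists_natCast_eq {c : ι → ℤ} (hc : 0 ≤ c) : ∃ d : ι →₀ ℕ, c = fun i => (d i : ℤ) :=
  ⟨Finsupp.equivFunOnFinite.symm fun i => (c i).toNat, funext fun i => by simpa using hc i⟩

lemma intCoeff_sub (B B' : MvPowerSeries ι K) (c : ι → ℤ) :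
    intCoeff (B - B') c = intCoeff B c - intCoeff B' c := by
  unfold intCoeff
  split_ifs <;> simp

lemma intCoeff_one (c : ι → ℤ) :
    intCoeff (1 : MvPowerSeries ι K) c = open Classical in if c = 0 then 1 else 0 := by
  classical
  by_cases hc : 0 ≤ c
  · obtain ⟨d, rfl⟩ := exists_natCast_eq hc
    rw [intCoeff_natCast, MvPowerSeries.coeff_one]
    refine if_congr ?_ rfl rfl
    simp [Finsupp.ext_iff, funext_iff]
  · rw [intCoeff_of_not_nonneg _ hc, if_neg]
    rintro rfl
    exact hc le_rfl

lemma intCoeff_mul (B B' : MvPowerSeries ι K) (c : ι → ℤ) :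
    intCoeff (B * B') c = ∑ᶠ p, intCoeff B p * intCoeff B' (c - p) := by
  classical
  have hz : ∀ p, ¬ (0 ≤ p ∧ p ≤ c) → intCoeff B p * intCoeff B' (c - p) = 0 := by
    intro p hp
    rw [not_and_or, ← sub_nonneg (b := p)] at hp
    rcases hp with h | h <;> simp [intCoeff_of_not_nonneg _ h]
  by_cases hc : 0 ≤ c
  · obtain ⟨d, rfl⟩ := exists_natCast_eq hc
    have inj : Function.Injective fun (p : ι →₀ ℕ) i => (p i : ℤ) := fun p p' h => by
      ext i
      exact Int.ofNat_injective (congrFun h i)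
    rw [intCoeff_natCast, MvPowerSeries.coeff_mul,
      finsum_eq_sum_of_support_subset (s := (antidiagonal d).image fun p i => (p.1 i : ℤ)),
      sum_image]
    · refine sum_congr rfl fun p hp => ?_
      rw [intCoeff_natCast, ← intCoeff_natCast B']
      congr 2
      ext i
      simp [← HasAntidiagonal.mem_antidiagonal.1 hp]
    · intro p hp p' hp' h
      have h1 : p.1 = p'.1 := inj h
      refine Prod.ext h1 (add_left_cancel (a := p.1) ?_)
      rw [HasAntidiagonal.mem_antidiagonal.1 hp, h1, HasAntidiagonal.mem_antidiagonal.1 hp']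
    · intro p hp
      by_contra hn
      refine hp (hz p fun h => hn ?_)
      obtain ⟨p, rfl⟩ := exists_natCast_eq h.1
      have hle : p ≤ d := fun i => Int.ofNat_le.1 (h.2 i)
      simp only [coe_image, Set.mem_image, mem_coe, HasAntidiagonal.mem_antidiagonal]
      exact ⟨(p, d - p), add_tsub_cancel_of_le hle, rfl⟩
  · rw [intCoeff_of_not_nonneg _ hc, finsum_eq_zero_of_forall_eq_zero]
    exact fun p => hz p fun h => hc (h.1.trans h.2)

lemma intCoeff_prod_comp (s : (ι → ℤ) ≃+ (ι → ℤ)) {J : Type*} (S : Finset J)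
    (f f' : J → MvPowerSeries ι K) (h : ∀ j ∈ S, ∀ c, intCoeff (f j) c = intCoeff (f' j) (s c))
    (c : ι → ℤ) : intCoeff (∏ j ∈ S, f j) c = intCoeff (∏ j ∈ S, f' j) (s c) := by
  classical
  induction S using Finset.induction_on generalizing c with
  | empty => simp [intCoeff_one]
  | insert j S hj ih =>
    rw [prod_insert hj, prod_insert hj, intCoeff_mul, intCoeff_mul,
      ← finsum_comp_equiv s.toEquiv (f := fun p => _ * intCoeff _ (s c - p))]
    refine finsum_congr fun p => ?_
    rw [h j (mem_insert_self _ _), ih fun j hj => h j (mem_insert_of_mem hj), map_sub]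
    rfl

/-- The multivariate series `P(y^α)`. -/
noncomputable def evalMonomial (α : ι → ℕ) (P : PowerSeries K) : MvPowerSeries ι K :=
  open Classical in fun c => ∑ᶠ k : ℕ, if k • α = c then PowerSeries.coeff k P else 0

lemma intCoeff_evalMonomial (α : ι → ℕ) (P : PowerSeries K) (c : ι → ℤ) :
    intCoeff (evalMonomial α P) c = open Classical in
      ∑ᶠ k : ℕ, if k • (fun i => (α i : ℤ)) = c then PowerSeries.coeff k P else 0 := by
  by_cases hc : 0 ≤ c
  · obtain ⟨d, rfl⟩ := exists_natCast_eq hc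
    rw [intCoeff_natCast]
    refine finsum_congr fun k => if_congr ?_ rfl rfl
    rw [funext_iff, funext_iff]
    exact forall_congr' fun i => by simp only [Pi.smul_apply, nsmul_eq_mul]; norm_cast
  · rw [intCoeff_of_not_nonneg _ hc, finsum_eq_zero_of_forall_eq_zero]
    intro k
    rw [if_neg]
    rintro rfl
    exact hc fun i => by simp; positivity

lemma coeff_evalMonomial_smul {α : ι → ℕ} (hα : α ≠ 0) (P : PowerSeries K) {k : ℕ}
    {c : ι →₀ ℕ} (hc : k • α = c) :
    MvPowerSeries.coeff c (evalMonomial α P) = PowerSeries.coeff k P := by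
  change ∑ᶠ k : ℕ, _ = _
  rw [finsum_eq_single _ k, if_pos hc]
  intro k' hk'
  rw [if_neg]
  intro h
  obtain ⟨i, hi⟩ := Function.ne_iff.1 hα
  have := congrFun (h.trans hc.symm) i
  exact hk' (Nat.eq_of_mul_eq_mul_right (Nat.pos_of_ne_zero hi) this)

lemma coeff_evalMonomial_eq_zero {α : ι → ℕ} (P : PowerSeries K) {c : ι →₀ ℕ}
    (hc : ∀ k : ℕ, k • α ≠ c) : MvPowerSeries.coeff c (evalMonomial α P) = 0 := by
  change ∑ᶠ k : ℕ, _ = _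
  simp only [hc, if_false, finsum_zero]

lemma constantCoeff_evalMonomial {α : ι → ℕ} (hα : α ≠ 0) (P : PowerSeries K) :
    MvPowerSeries.constantCoeff (evalMonomial α P) = PowerSeries.constantCoeff P := by
  rw [← MvPowerSeries.coeff_zero_eq_constantCoeff_apply,
    coeff_evalMonomial_smul hα (k := 0) P (by simp), PowerSeries.coeff_zero_eq_constantCoeff_apply]

variable [DecidableEq ι]

lemma coeff_mul_evalMonomial_single (B : MvPowerSeries ι K) (i : ι) (P : PowerSeries K)
    (c : ι →₀ ℕ) :
    MvPowerSeries.coeff c (B * evalMonomial (Pi.single i 1) P)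
      = ∑ p ∈ antidiagonal (c i),
        MvPowerSeries.coeff (c.update i p.1) B * PowerSeries.coeff p.2 P := by
  have hα : (Pi.single i 1 : ι → ℕ) ≠ 0 := Pi.single_ne_zero_iff.2 one_ne_zero
  have hk : ∀ k : ℕ, k • (Pi.single i 1 : ι → ℕ) = Finsupp.single i k := fun k => by
    rw [Finsupp.single_eq_pi_single, ← Pi.single_smul, smul_eq_mul, mul_one]
  rw [MvPowerSeries.coeff_mul]
  symm
  refine sum_of_injOn (fun p => (c.update i p.1, Finsupp.single i p.2)) ?_ ?_ ?_ ?_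
  · intro p _ p' _ h
    simp only [Prod.mk.injEq] at h
    refine Prod.ext ?_ (Finsupp.single_injective i h.2)
    simpa using DFunLike.congr_fun h.1 i
  · intro p hp
    simp only [mem_coe, HasAntidiagonal.mem_antidiagonal] at hp ⊢
    ext j
    rcases eq_or_ne j i with rfl | h
    · simp [hp]
    · simp [Function.update_of_ne h, Finsupp.single_eq_of_ne h]
  · rintro ⟨a, b⟩ hab hn
    rw [coeff_evalMonomial_eq_zero, mul_zero]
    intro k hb
    rw [hk] at hb
    obtain rfl : Finsupp.single i k = b := DFunLike.coe_injective hb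
    have hab := HasAntidiagonal.mem_antidiagonal.1 hab
    refine hn ⟨(a i, k), ?_, ?_⟩
    · simpa using DFunLike.congr_fun hab i
    · refine Prod.ext ?_ rfl
      ext j
      rcases eq_or_ne j i with rfl | h
      · simp
      · simp [Function.update_of_ne h, ← hab, Finsupp.single_eq_of_ne h]
  · intro p _
    rw [coeff_evalMonomial_smul hα P (hk p.2)]

/-- The simple reflection `sᵢ`. -/
def reflect (A : Matrix ι ι ℤ) (hdiag : ∀ i, A i i = 2) (i : ι) : (ι → ℤ) ≃+ (ι → ℤ) :=
  have h : Function.Involutive fun c : ι → ℤ => c - (∑ j, A i j * c j) • Pi.single i 1 := by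
    intro c
    have : ∑ j, A i j * (c - (∑ j, A i j * c j) • Pi.single i 1 : ι → ℤ) j = -∑ j, A i j * c j := by
      have hx : ∀ x : ℤ, ∑ j, A i j * (x • Pi.single i 1 : ι → ℤ) j = 2 * x := fun x => by
        rw [sum_eq_single i] <;> simp +contextual [hdiag]
      simp only [Pi.sub_apply, mul_sub, sum_sub_distrib, hx]
      ring
    simp only [this]
    simp
  { h.toPerm with
    map_add' := fun c d => by
      change _ - _ = _ - _ + (_ - _)
      simp only [Pi.add_apply, mul_add, sum_add_distrib, add_smul]
      abel }

variable {A : Matrix ι ι ℤ} {hdiag : ∀ i, A i i = 2}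

lemma reflect_apply (i : ι) (c : ι → ℤ) :
    reflect A hdiag i c = c + (-∑ j, A i j * c j) • Pi.single i 1 := by
  rw [neg_smul, ← sub_eq_add_neg]
  rfl

lemma reflect_reflect (i : ι) (c : ι → ℤ) : reflect A hdiag i (reflect A hdiag i c) = c :=
  (reflect A hdiag i).symm_apply_apply c

lemma reflect_apply_of_ne {i j : ι} (h : j ≠ i) (c : ι → ℤ) : reflect A hdiag i c j = c j := by
  simp [reflect_apply, h]

lemma reflect_apply_self (hoff : ∀ i j, i ≠ j → A i j = 0 ∨ A i j = -1) (i : ι) (c : ι → ℤ) :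
    reflect A hdiag i c i = ∑ j, ((-A i j).toNat : ℤ) * c j - c i := by
  simp [reflect_apply, sum_mul_eq hdiag hoff i c]
  ring

lemma bilForm_reflect (hA : A.IsSymm) (i : ι) (c : ι → ℤ) :
    bilForm A (reflect A hdiag i c) (reflect A hdiag i c) = bilForm A c c := by
  rw [reflect_apply, bilForm.add_smul_single hA hdiag]
  ring

end QSeries

namespace QSeries

open Finset

variable {ι : Type*} [Fintype ι] [DecidableEq ι] {K : Type*} [Field K]

lemma redTupleSeries_mul {q : K} (h0 : q ≠ 0) {A : Matrix ι ι ℤ} (hA : A.IsSymm)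
    (hdiag : ∀ i, A i i = 2) (hoff : ∀ i j, i ≠ j → A i j = 0 ∨ A i j = -1)
    {E : (ι → ℕ → ℕ) → ℤ}
    (hE : ∀ r, 2 * E r = ∑ᶠ t : ℕ, bilForm A (fun i => (r i t : ℤ)) fun i => (r i t : ℤ))
    (i : ι) :
    redTupleSeries q A E i * evalMonomial (Pi.single i 1) (eulerSeries q) = tupleSeries q E := by
  ext c
  rw [coeff_mul_evalMonomial_single, coeff_tupleSeries h0 hA hdiag hoff hE i]
  simp only [← rowPoly_mul, PowerSeries.coeff_mul, mul_sum]
  rw [sum_comm]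
  refine sum_congr rfl fun p _ => ?_
  change (∑ r ∈ rows (Function.update (c.update i p.1) i 0), weight q E r *
    PowerSeries.coeff (c.update i p.1 i) (rowPoly q fun t => (nbrSum A i r t : ℤ))) * _ = _
  rw [Finsupp.coe_update, Function.update_idem, Function.update_self, sum_mul]
  exact sum_congr rfl fun r _ => by ring

lemma intCoeff_redTupleSeries (q : K) (A : Matrix ι ι ℤ) (E : (ι → ℕ → ℕ) → ℤ) (i : ι)
    {c : ι → ℤ} (d : ι → ℕ) (hc : ∀ j, j ≠ i → c j = d j) :
    intCoeff (redTupleSeries q A E i) c = ∑ r ∈ rows (Function.update d i 0),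
      weight q E r * zcoeff (rowPoly q fun t => (nbrSum A i r t : ℤ)) (c i) := by
  by_cases hi : 0 ≤ c i
  · have h : c = fun j => (Finsupp.equivFunOnFinite.symm (Function.update d i (c i).toNat) j : ℤ) := by
      ext j
      rcases eq_or_ne j i with rfl | h
      · simp [hi]
      · simp [h, hc j h]
    conv_lhs => rw [h]
    rw [intCoeff_natCast]
    change ∑ r ∈ rows (Function.update (Function.update d i (c i).toNat) i 0), weight q E r *
      PowerSeries.coeff (Function.update d i (c i).toNat i) _ = _
    rw [Function.update_idem, Function.update_self]
    refine sum_congr rfl fun r _ => ?_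
    rw [zcoeff, if_pos hi]
  · rw [intCoeff_of_not_nonneg _ fun h => hi (h i)]
    refine (sum_eq_zero fun r _ => ?_).symm
    rw [zcoeff_of_neg _ (not_le.1 hi), mul_zero]

lemma intCoeff_redTupleSeries_reflect {q : K} (h0 : q ≠ 0) (hq : ∀ n : ℕ, q ^ (n + 1) ≠ 1)
    {A : Matrix ι ι ℤ} (hdiag : ∀ i, A i i = 2)
    (hoff : ∀ i j, i ≠ j → A i j = 0 ∨ A i j = -1) (E : (ι → ℕ → ℕ) → ℤ) (i : ι) (c : ι → ℤ) :
    intCoeff (redTupleSeries q A E i) c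
      = intCoeff (redTupleSeries q A E i) (reflect A hdiag i c) := by
  by_cases hc : ∀ j, j ≠ i → 0 ≤ c j
  · rw [intCoeff_redTupleSeries q A E i (fun j => (c j).toNat) fun j hj => by simp [hc j hj],
      intCoeff_redTupleSeries q A E i (fun j => (c j).toNat) fun j hj => by
        simp [reflect_apply_of_ne hj, hc j hj]]
    refine sum_congr rfl fun r hr => ?_
    obtain ⟨hr, hsum⟩ := mem_rows.1 hr
    rw [zcoeff_rowPoly_symm h0 hq (isDescending_nbrSum A i hr), reflect_apply_self hoff]
    congr 3
    rw [finsum_nbrSum A i hr, Nat.cast_sum]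
    refine sum_congr rfl fun j _ => ?_
    rw [hsum, Nat.cast_mul]
    rcases eq_or_ne j i with rfl | h
    · simp [hdiag]
    · simp [h, hc j h]
  · push Not at hc
    obtain ⟨j, hj, hlt⟩ := hc
    rw [intCoeff_of_not_nonneg _ fun h => not_le.2 hlt (h j), intCoeff_of_not_nonneg _ fun h => ?_]
    have := h j
    rw [reflect_apply_of_ne hj] at this
    exact not_le.2 hlt this

section Roots

variable {A : Matrix ι ι ℤ} (hA : A.IsSymm) (hdiag : ∀ i, A i i = 2)
  (hoff : ∀ i j, i ≠ j → A i j = 0 ∨ A i j = -1)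
  (hpos : ∀ c : ι → ℤ, c ≠ 0 → 0 < bilForm A c c)

include hA hoff hpos in
lemma reflect_nonneg {i : ι} {α : ι → ℤ} (h0 : 0 ≤ α) (hα : bilForm A α α = 2)
    (hi : α ≠ Pi.single i 1) : 0 ≤ reflect A hdiag i α := by
  by_contra hneg
  have hlt : reflect A hdiag i α i < 0 := by
    by_contra h
    refine hneg fun j => ?_
    rcases eq_or_ne j i with rfl | hj
    · exact not_lt.1 h
    · rw [reflect_apply_of_ne hj]
      exact h0 j
  set k := reflect A hdiag i α i with hk
  have hsplit : reflect A hdiag i α = Function.update α i 0 + k • Pi.single i 1 := by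
    ext j
    rcases eq_or_ne j i with rfl | hj
    · simp [← hk]
    · simp [hj, reflect_apply_of_ne hj]
  have h2 := bilForm_reflect (hdiag := hdiag) hA i α
  have hle : ∑ j, A i j * Function.update α i 0 j ≤ 0 := by
    rw [sum_mul_eq hdiag hoff, Function.update_self, mul_zero, zero_sub, neg_nonpos]
    refine sum_nonneg fun j _ => mul_nonneg (Int.natCast_nonneg _) ?_
    rcases eq_or_ne j i with rfl | hj
    · simp
    · simpa [hj] using h0 j
  rw [hsplit, bilForm.add_smul_single hA hdiag, hα] at h2
  have hu : Function.update α i 0 = 0 := by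
    by_contra hne
    have := hpos _ hne
    nlinarith
  have hα' : α = 0 + α i • Pi.single i 1 := by
    ext j
    rcases eq_or_ne j i with rfl | hj
    · simp
    · simpa [hj] using congrFun hu j
  rw [hα', bilForm.add_smul_single hA hdiag] at hα
  have h1 : α i ^ 2 = 1 := by simpa [bilForm] using hα
  have : α i = 1 := (pow_eq_one_iff_of_nonneg (h0 i) two_ne_zero).1 h1
  exact hi (by rw [hα', this]; simp)

variable {Φ : Finset (ι → ℕ)}
  (hΦ : ∀ c : ι → ℕ, c ∈ Φ ↔ bilForm A (fun i => (c i : ℤ)) (fun i => (c i : ℤ)) = 2)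

include hA hoff hpos hΦ in
lemma exists_mem_erase_natCast_eq_reflect {i : ι} {α : ι → ℕ} (hα : α ∈ Φ.erase (Pi.single i 1)) :
    ∃ β ∈ Φ.erase (Pi.single i 1),
      (fun j => (β j : ℤ)) = reflect A hdiag i fun j => (α j : ℤ) := by
  obtain ⟨hne, hα⟩ := mem_erase.1 hα
  have h0 : (0 : ι → ℤ) ≤ fun j => (α j : ℤ) := fun j => Int.natCast_nonneg _
  have hne' : (fun j => (α j : ℤ)) ≠ Pi.single i 1 := by
    refine fun h => hne (funext fun j => ?_)
    have := congrFun h j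
    rcases eq_or_ne j i with rfl | hj
    · simpa using this
    · simpa [hj] using this
  obtain ⟨β, hβ⟩ := exists_natCast_eq
    (reflect_nonneg hA hdiag hoff hpos h0 ((hΦ α).1 hα) hne')
  refine ⟨β, mem_erase.2 ⟨fun h => ?_, ?_⟩, hβ.symm⟩
  · have hs : (fun j => (β j : ℤ)) = Pi.single i 1 := by
      ext j
      rw [h]
      rcases eq_or_ne j i with rfl | hj <;> simp [*]
    rw [← reflect_reflect (hdiag := hdiag) i fun j => (α j : ℤ), hβ, hs] at h0
    have := h0 i
    rw [reflect_apply] at this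
    simp [Pi.single_apply, hdiag] at this
  · rw [hΦ, ← hβ, bilForm_reflect hA]
    exact (hΦ α).1 hα

include hA hoff hpos hΦ in
lemma intCoeff_prod_erase_reflect (P : PowerSeries K) (i : ι) (c : ι → ℤ) :
    intCoeff (∏ α ∈ Φ.erase (Pi.single i 1), evalMonomial α P) c
      = intCoeff (∏ α ∈ Φ.erase (Pi.single i 1), evalMonomial α P) (reflect A hdiag i c) := by
  have hex : ∀ α : ι → ℕ, ∃ β : ι → ℕ, α ∈ Φ.erase (Pi.single i 1) →
      β ∈ Φ.erase (Pi.single i 1) ∧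
        (fun j => (β j : ℤ)) = reflect A hdiag i fun j => (α j : ℤ) := by
    intro α
    by_cases hα : α ∈ Φ.erase (Pi.single i 1)
    · obtain ⟨β, h⟩ := exists_mem_erase_natCast_eq_reflect hA hdiag hoff hpos hΦ hα
      exact ⟨β, fun _ => h⟩
    · exact ⟨0, fun h => absurd h hα⟩
  choose σ hσ using hex
  have inv : ∀ α ∈ Φ.erase (Pi.single i 1), σ (σ α) = α := by
    intro α hα
    have h := (hσ _ (hσ α hα).1).2
    rw [(hσ α hα).2, reflect_reflect] at h
    exact funext fun j => Int.ofNat_injective (congrFun h j)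
  have key := intCoeff_prod_comp (reflect A hdiag i) (Φ.erase (Pi.single i 1))
    (fun α => evalMonomial α P) (fun α => evalMonomial (σ α) P) (fun α hα c => by
      rw [intCoeff_evalMonomial, intCoeff_evalMonomial, (hσ α hα).2]
      refine finsum_congr fun k => if_congr ?_ rfl rfl
      rw [← map_nsmul, (reflect A hdiag i).injective.eq_iff]) c
  rw [key]
  congr 1
  exact prod_nbij' σ σ (fun α hα => (hσ α hα).1) (fun α hα => (hσ α hα).1) inv inv fun _ _ => rfl

end Roots

lemma coeff_mul_of_forall_degree_lt {ι : Type*} {H : MvPowerSeries ι K} {n : ℕ}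
    (hH : ∀ d : ι →₀ ℕ, d.degree < n → MvPowerSeries.coeff d H = 0) (U : MvPowerSeries ι K)
    {c : ι →₀ ℕ} (hc : c.degree ≤ n) :
    MvPowerSeries.coeff c (H * U)
      = MvPowerSeries.coeff c H * MvPowerSeries.constantCoeff U := by
  classical
  rw [MvPowerSeries.coeff_mul, sum_eq_single (c, 0)]
  · rfl
  · rintro ⟨a, b⟩ hab hne
    have hab := HasAntidiagonal.mem_antidiagonal.1 hab
    have hb : b ≠ 0 := by
      rintro rfl
      exact hne (by rw [← hab, add_zero])
    have hb' : 0 < b.degree := Nat.pos_of_ne_zero fun h => hb ((Finsupp.degree_eq_zero_iff b).1 h)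
    have : a.degree + b.degree = c.degree := by rw [← map_add]; exact congrArg _ hab
    rw [hH a (by omega), zero_mul]
  · simp

theorem tupleSeries_eq_prod {q : K} (h0 : q ≠ 0) (hq : ∀ n : ℕ, q ^ (n + 1) ≠ 1)
    {A : Matrix ι ι ℤ} (hA : A.IsSymm)
    (hdiag : ∀ i, A i i = 2) (hoff : ∀ i j, i ≠ j → A i j = 0 ∨ A i j = -1)
    (hpos : ∀ c : ι → ℤ, c ≠ 0 → 0 < bilForm A c c) {Φ : Finset (ι → ℕ)}
    (hΦ : ∀ c : ι → ℕ, c ∈ Φ ↔ bilForm A (fun i => (c i : ℤ)) (fun i => (c i : ℤ)) = 2)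
    {E : (ι → ℕ → ℕ) → ℤ}
    (hE : ∀ r, 2 * E r = ∑ᶠ t : ℕ, bilForm A (fun i => (r i t : ℤ)) fun i => (r i t : ℤ)) :
    tupleSeries q E = ∏ α ∈ Φ, evalMonomial α (eulerSeries q) := by
  have hΦ0 : ∀ α ∈ Φ, α ≠ 0 := by
    rintro α hα rfl
    simp [hΦ, bilForm] at hα
  ext c
  induction hn : c.degree using Nat.strong_induction_on generalizing c with
  | _ n ih =>
  set F := tupleSeries q E
  set G := ∏ α ∈ Φ, evalMonomial α (eulerSeries q)
  have hlow : ∀ d : ι →₀ ℕ, d.degree < n → MvPowerSeries.coeff d (F - G) = 0 := fun d hd => by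
    rw [map_sub, ih _ hd d rfl, sub_self]
  by_contra hne
  have hAc : ∀ i, ∑ j, A i j * (c j : ℤ) ≤ 0 := by
    intro i
    have hs1 : (Pi.single i 1 : ι → ℕ) ≠ 0 := Pi.single_ne_zero_iff.2 one_ne_zero
    have hmem : (Pi.single i 1 : ι → ℕ) ∈ Φ := by
      have : (fun j => ((Pi.single i 1 : ι → ℕ) j : ℤ)) = Pi.single i 1 := by
        ext j
        rcases eq_or_ne j i with rfl | hj <;> simp [*]
      rw [hΦ, this, bilForm.single_single, hdiag]
    set e : MvPowerSeries ι K := evalMonomial (Pi.single i 1) (eulerSeries q)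
    have he : MvPowerSeries.constantCoeff e ≠ 0 := by
      rw [constantCoeff_evalMonomial hs1, constantCoeff_eulerSeries]
      exact one_ne_zero
    set D := redTupleSeries q A E i
      - ∏ α ∈ Φ.erase (Pi.single i 1), evalMonomial α (eulerSeries q) with hDdef
    have hD : (F - G) * e⁻¹ = D := by
      rw [eq_comm, MvPowerSeries.eq_mul_inv_iff_mul_eq he, sub_mul, redTupleSeries_mul h0 hA hdiag hoff hE,
        prod_erase_mul _ _ hmem]
    have hcoeff : ∀ d : ι →₀ ℕ, d.degree ≤ n → MvPowerSeries.coeff d D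
        = MvPowerSeries.coeff d (F - G) * MvPowerSeries.constantCoeff e⁻¹ := fun d hd => by
      rw [← hD, coeff_mul_of_forall_degree_lt hlow _ hd]
    have hDc : MvPowerSeries.coeff c D ≠ 0 := by
      rw [hcoeff c hn.le, map_sub, MvPowerSeries.constantCoeff_inv]
      exact mul_ne_zero (sub_ne_zero.2 hne) (inv_ne_zero he)
    have hinv : intCoeff D (fun j => (c j : ℤ))
        = intCoeff D (reflect A hdiag i fun j => (c j : ℤ)) := by
      rw [hDdef, intCoeff_sub, intCoeff_sub, intCoeff_redTupleSeries_reflect h0 hq hdiag hoff,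
        intCoeff_prod_erase_reflect hA hdiag hoff hpos hΦ]
    rw [intCoeff_natCast] at hinv
    rw [hinv] at hDc
    obtain ⟨d, hd⟩ := exists_natCast_eq
      (not_not.1 fun h => hDc (intCoeff_of_not_nonneg D h))
    rw [hd, intCoeff_natCast] at hDc
    have hdeg : n ≤ d.degree := by
      by_contra h
      exact hDc (by rw [hcoeff d (by omega), hlow d (by omega), zero_mul])
    have hsum : (d.degree : ℤ) = c.degree - ∑ j, A i j * (c j : ℤ) := by
      rw [Finsupp.degree_eq_sum, Finsupp.degree_eq_sum, Nat.cast_sum, Nat.cast_sum]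
      have : ∀ j, (d j : ℤ) = reflect A hdiag i (fun j => (c j : ℤ)) j := fun j => by rw [hd]
      simp only [this, reflect_apply, Pi.add_apply, sum_add_distrib, Pi.smul_apply, smul_eq_mul,
        ← mul_sum]
      simp
      ring
    omega
  have hc0 : c = 0 := by
    by_contra hc
    have := hpos (fun i => (c i : ℤ)) fun h => hc (Finsupp.ext fun i => by
      simpa using congrFun h i)
    refine this.not_ge ?_
    rw [bilForm]
    simp only [mul_assoc, ← mul_sum]
    exact sum_nonpos fun i _ => mul_nonpos_of_nonneg_of_nonpos (Int.natCast_nonneg _) (hAc i)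
  subst hc0
  refine hne ?_
  have hE0 : E 0 = 0 := by
    have := hE 0
    simpa [bilForm] using this
  have hF : MvPowerSeries.coeff 0 F = 1 := by
    change ∑ r ∈ rows (fun _ => 0), weight q E r = 1
    have : rows (fun _ : ι => 0) = {0} := by
      ext r
      simp [rows, IsDescending.withSum_zero, funext_iff]
    rw [this, sum_singleton, weight, hE0]
    simp
  rw [hF, MvPowerSeries.coeff_zero_eq_constantCoeff_apply, map_prod]
  refine (prod_eq_one fun α hα => ?_).symm
  rw [constantCoeff_evalMonomial (hΦ0 α hα), constantCoeff_eulerSeries]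

end QSeries

lemma RingHom.map_ringInverse {R S : Type*} [Semiring R] [Semiring S] (f : R →+* S) {u : R}
    (hu : IsUnit u) : f (Ring.inverse u) = Ring.inverse (f u) := by
  obtain ⟨u, rfl⟩ := hu
  have h := Ring.inverse_unit (Units.map (f : R →* S) u)
  rw [Ring.inverse_unit]
  exact h.symm

namespace QSeries

open Finset PowerSeries

section Slice

variable {l : ℕ}

/-- The function underlying `slice`. -/
noncomputable def sliceFun (p : MvPowerSeries (Fin (l + 1)) ℤ) : MvPowerSeries (Fin l) ℤ⟦X⟧ :=
  fun c => PowerSeries.mk fun n =>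
    MvPowerSeries.coeff c (coeff n (MvPowerSeries.finSuccEquiv ℤ l p))

lemma coeff_coeff_sliceFun (p : MvPowerSeries (Fin (l + 1)) ℤ) (c : Fin l →₀ ℕ) (n : ℕ) :
    coeff n (MvPowerSeries.coeff c (sliceFun p))
      = MvPowerSeries.coeff c (coeff n (MvPowerSeries.finSuccEquiv ℤ l p)) :=
  coeff_mk n fun n => MvPowerSeries.coeff c (coeff n (MvPowerSeries.finSuccEquiv ℤ l p))

/-- View a power series in `q, y₁, …, y_l` as a series in `y₁, …, y_l` over `ℤ⟦q⟧`. -/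
noncomputable def slice (l : ℕ) :
    MvPowerSeries (Fin (l + 1)) ℤ →+* MvPowerSeries (Fin l) ℤ⟦X⟧ where
  toFun := sliceFun
  map_zero' := by
    ext c n
    rw [coeff_coeff_sliceFun]
    simp
  map_add' p p' := by
    ext c n
    rw [coeff_coeff_sliceFun]
    simp [coeff_coeff_sliceFun]
  map_one' := by
    ext c n
    rw [coeff_coeff_sliceFun, map_one, coeff_one, MvPowerSeries.coeff_one]
    split_ifs with h h' h' <;> simp [MvPowerSeries.coeff_one, coeff_one, h, h']
  map_mul' p p' := by
    ext c n
    rw [coeff_coeff_sliceFun, MvPowerSeries.coeff_mul, map_sum, map_mul, coeff_mul, map_sum]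
    simp only [MvPowerSeries.coeff_mul, coeff_mul, coeff_coeff_sliceFun]
    rw [sum_comm]

lemma coeff_coeff_slice (p : MvPowerSeries (Fin (l + 1)) ℤ) (c : Fin l →₀ ℕ) (n : ℕ) :
    coeff n (MvPowerSeries.coeff c (slice l p)) = MvPowerSeries.coeff (c.cons n) p := by
  rw [← MvPowerSeries.coeff_coeff_finSuccEquiv]
  exact coeff_coeff_sliceFun p c n

lemma slice_injective : Function.Injective (slice l) := by
  intro p p' h
  ext d
  rw [← Finsupp.cons_tail d, ← coeff_coeff_slice, h, coeff_coeff_slice]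

lemma slice_surjective : Function.Surjective (slice l) := by
  intro s
  let p : MvPowerSeries (Fin (l + 1)) ℤ := fun d => coeff (d 0) (MvPowerSeries.coeff d.tail s)
  have hp : ∀ d, MvPowerSeries.coeff d p = coeff (d 0) (MvPowerSeries.coeff d.tail s) :=
    fun _ => rfl
  refine ⟨p, ?_⟩
  ext c n
  rw [coeff_coeff_slice, hp, Finsupp.cons_zero, Finsupp.tail_cons]

lemma slice_X_zero : slice l (MvPowerSeries.X 0) = MvPowerSeries.C X := by
  ext c n
  change coeff n (MvPowerSeries.coeff c (sliceFun _)) = _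
  rw [coeff_coeff_sliceFun, MvPowerSeries.finSuccEquiv_X_zero, coeff_X, MvPowerSeries.coeff_C]
  split_ifs with h h' h' <;> simp [MvPowerSeries.coeff_one, coeff_X, h, h']

lemma slice_X_succ (i : Fin l) : slice l (MvPowerSeries.X i.succ) = MvPowerSeries.X i := by
  ext c n
  change coeff n (MvPowerSeries.coeff c (sliceFun _)) = _
  rw [coeff_coeff_sliceFun, MvPowerSeries.finSuccEquiv_X_succ, coeff_C, MvPowerSeries.coeff_X]
  split_ifs with h h' h' <;> simp [MvPowerSeries.coeff_X, coeff_one, h, h']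

lemma slice_prod_X_pow (c : Fin l → ℕ) :
    slice l (∏ i, MvPowerSeries.X i.succ ^ c i)
      = MvPowerSeries.monomial (Finsupp.equivFunOnFinite.symm c) 1 := by
  rw [MvPowerSeries.monomial_one_eq, Finsupp.prod_fintype _ _ fun i => pow_zero _]
  simp [slice_X_succ]

end Slice

lemma isUnit_qPoch_X {R : Type*} [CommRing R] (n : ℕ) : IsUnit (qPoch (X : R⟦X⟧) n) := by
  rw [PowerSeries.isUnit_iff_constantCoeff]
  simp [qPoch]

lemma isUnit_qPoch_mvX {σ R : Type*} [CommRing R] (i : σ) (n : ℕ) :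
    IsUnit (qPoch (MvPowerSeries.X i : MvPowerSeries σ R) n) := by
  rw [MvPowerSeries.isUnit_iff_constantCoeff]
  simp [qPoch]

lemma map_qPoch {R S : Type*} [CommRing R] [CommRing S] (f : R →+* S) (q : R) (n : ℕ) :
    f (qPoch q n) = qPoch (f q) n := by
  simp [qPoch]

section EvalMonomial

variable {ι : Type*} [Fintype ι] {R : Type*} [CommRing R]

lemma evalMonomial_eq_subst {α : ι → ℕ} (hα : α ≠ 0) (P : R⟦X⟧) :
    evalMonomial α P
      = P.subst (MvPowerSeries.monomial (Finsupp.equivFunOnFinite.symm α) (1 : R)) := by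
  classical
  have hs := HasSubst.monomial (n := Finsupp.equivFunOnFinite.symm α) (s := (1 : R))
    fun h => hα (funext fun i => DFunLike.congr_fun h i)
  ext c
  rw [coeff_subst hs]
  refine finsum_congr fun k => ?_
  rw [MvPowerSeries.monomial_pow, one_pow, MvPowerSeries.coeff_monomial, smul_eq_mul, mul_ite,
    mul_one, mul_zero]
  exact if_congr ⟨fun h => DFunLike.coe_injective h.symm, fun h => by rw [h]; rfl⟩ rfl rfl

lemma map_evalMonomial {S : Type*} [CommRing S] (f : R →+* S) {α : ι → ℕ} (hα : α ≠ 0)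
    (P : R⟦X⟧) :
    MvPowerSeries.map f (evalMonomial α P) = evalMonomial α (PowerSeries.map f P) := by
  ext c
  rw [MvPowerSeries.coeff_map]
  by_cases h : ∃ k : ℕ, k • α = c
  · obtain ⟨k, hk⟩ := h
    rw [coeff_evalMonomial_smul hα _ hk, coeff_evalMonomial_smul hα _ hk, PowerSeries.coeff_map]
  · push Not at h
    rw [coeff_evalMonomial_eq_zero _ h, coeff_evalMonomial_eq_zero _ h, map_zero]

end EvalMonomial

/-- The series `∏_{n > N} (1 - qⁿ z)⁻¹` in `z`, over `ℤ⟦q⟧`. -/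
noncomputable def eulerTail (N : ℕ) : ℤ⟦X⟧⟦X⟧ :=
  PowerSeries.mk fun k => X ^ (k * (N + 1)) * Ring.inverse (qPoch X k)

lemma one_sub_mul_eulerTail (N : ℕ) :
    (1 - C (X ^ (N + 1)) * X) * eulerTail N = eulerTail (N + 1) := by
  have hinv : ∀ k, qPoch (X : ℤ⟦X⟧) k * Ring.inverse (qPoch X k) = 1 := fun k =>
    Ring.mul_inverse_cancel _ (isUnit_qPoch_X k)
  ext1 k
  cases k with
  | zero => simp [eulerTail, sub_mul, mul_assoc]
  | succ k =>
    rw [sub_mul, one_mul, mul_assoc, map_sub, coeff_C_mul, coeff_succ_X_mul, eulerTail, eulerTail,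
      coeff_mk, coeff_mk, coeff_mk]
    refine (isUnit_qPoch_X (R := ℤ) (k + 1)).mul_left_cancel ?_
    have h1 := hinv k
    have h2 := hinv (k + 1)
    set a := Ring.inverse (qPoch (X : ℤ⟦X⟧) k)
    set b := Ring.inverse (qPoch (X : ℤ⟦X⟧) (k + 1))
    have h3 : qPoch (X : ℤ⟦X⟧) (k + 1) * a = 1 - X ^ (k + 1) := by
      rw [qPoch_succ]
      linear_combination (1 - X ^ (k + 1)) * h1
    linear_combination (X ^ ((k + 1) * (N + 1)) - X ^ ((k + 1) * (N + 1 + 1))) * h2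
      - X ^ (N + 1) * X ^ (k * (N + 1)) * h3

lemma coeff_coeff_eulerTail {N n : ℕ} (h : n ≤ N) {k : ℕ} (hk : k ≠ 0) :
    coeff n (coeff k (eulerTail N)) = 0 := by
  rw [eulerTail, coeff_mk, coeff_X_pow_mul', if_neg]
  have : 1 * (N + 1) ≤ k * (N + 1) := Nat.mul_le_mul_right _ (Nat.pos_of_ne_zero hk)
  omega

open Filter Topology in
lemma slice_tprod {l : ℕ} {α : Fin l → ℕ} (hα : α ≠ 0) :
    slice l (∏' n : ℕ, Ring.inverse (1 - (MvPowerSeries.X 0 : MvPowerSeries (Fin (l + 1)) ℤ) ^ (n + 1)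
      * ∏ i : Fin l, MvPowerSeries.X i.succ ^ α i)) = evalMonomial α (eulerTail 0) := by
  have : T2Space (MvPowerSeries (Fin (l + 1)) ℤ) := MvPowerSeries.WithPiTopology.instT2Space
  have : IsTopologicalRing (MvPowerSeries (Fin (l + 1)) ℤ) :=
    MvPowerSeries.WithPiTopology.instIsTopologicalRing _ _
  set Y : MvPowerSeries (Fin (l + 1)) ℤ := ∏ i : Fin l, MvPowerSeries.X i.succ ^ α i with hY
  set u : ℕ → MvPowerSeries (Fin (l + 1)) ℤ := fun n => 1 - MvPowerSeries.X 0 ^ (n + 1) * Y with hu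
  have hunit : ∀ n, IsUnit (u n) := fun n => by
    rw [MvPowerSeries.isUnit_iff_constantCoeff]
    simp [u]
  choose H hH using fun N => slice_surjective (evalMonomial α (eulerTail N))
  have hrec : ∀ N, H N = Ring.inverse (u N) * H (N + 1) := by
    intro N
    refine (hunit N).mul_left_cancel ?_
    rw [← mul_assoc, Ring.mul_inverse_cancel _ (hunit N), one_mul]
    have hs := HasSubst.monomial (n := Finsupp.equivFunOnFinite.symm α) (s := (1 : ℤ⟦X⟧))
      fun h => hα (funext fun i => DFunLike.congr_fun h i)
    have h1 : (1 : ℤ⟦X⟧⟦X⟧).subst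
        (MvPowerSeries.monomial (Finsupp.equivFunOnFinite.symm α) (1 : ℤ⟦X⟧)) = 1 := by
      rw [← coe_substAlgHom hs]
      exact map_one _
    apply slice_injective
    rw [map_mul, hH, hH, ← one_sub_mul_eulerTail, evalMonomial_eq_subst hα,
      evalMonomial_eq_subst hα, subst_mul hs, subst_sub hs, subst_mul hs, subst_X hs, subst_C, h1, hu]
    simp only [map_sub, map_one, map_mul, map_pow, slice_X_zero, hY, slice_prod_X_pow]
  have hprod : ∀ N, H 0 = (∏ n ∈ range N, Ring.inverse (u n)) * H N := by
    intro N
    induction N with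
    | zero => simp
    | succ N ih => rw [ih, prod_range_succ, mul_assoc, ← hrec]
  have hlim : Tendsto H atTop (𝓝 1) := by
    refine (MvPowerSeries.WithPiTopology.tendsto_iff_coeff_tendsto _ _ _).2 fun d => ?_
    refine tendsto_atTop_of_eventually_const (i₀ := d 0) fun N hN => ?_
    rw [← Finsupp.cons_tail d, ← coeff_coeff_slice, ← coeff_coeff_slice, hH, map_one]
    by_cases hd : d.tail = 0
    · rw [hd, coeff_evalMonomial_smul hα (k := 0) _ (by simp)]
      simp [eulerTail]
    · rw [MvPowerSeries.coeff_one, if_neg hd, (coeff (d 0)).map_zero]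
      by_cases h : ∃ k : ℕ, k • α = d.tail
      · obtain ⟨k, hk⟩ := h
        rw [coeff_evalMonomial_smul hα _ hk, coeff_coeff_eulerTail hN]
        rintro rfl
        exact hd (DFunLike.coe_injective (by rw [← hk]; simp))
      · push Not at h
        rw [coeff_evalMonomial_eq_zero _ h, map_zero]
  have hmult : Multipliable fun n => Ring.inverse (u n) := by
    have h1 : ∀ n, Ring.inverse (u n)
        = 1 + MvPowerSeries.X 0 ^ (n + 1) * (Y * Ring.inverse (u n)) := fun n => by
      have := Ring.mul_inverse_cancel _ (hunit n)
      simp only [u] at this ⊢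
      linear_combination this
    have hord : Tendsto (fun n => (MvPowerSeries.X 0 ^ (n + 1) * (Y * Ring.inverse (u n))).order)
        atTop (𝓝 ⊤) := by
      refine ENat.tendsto_nhds_top_iff_natCast_lt.2 fun m => ?_
      filter_upwards [eventually_ge_atTop m] with n hn
      refine lt_of_lt_of_le ?_ (le_trans le_self_add (MvPowerSeries.le_order_mul ..))
      refine lt_of_lt_of_le ?_ (MvPowerSeries.le_order_pow_of_constantCoeff_eq_zero (n + 1) (by simp))
      exact_mod_cast Nat.lt_succ_of_le hn
    have := MvPowerSeries.WithPiTopology.multipliable_one_add_of_tendsto_order_atTop_nhds_top hord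
    simp only [← h1] at this
    exact this
  have h := (hmult.hasProd.tendsto_prod_nat.mul hlim)
  simp only [← hprod, mul_one] at h
  change slice l (∏' n, Ring.inverse (u n)) = _
  rw [tendsto_nhds_unique h tendsto_const_nhds, hH]

end QSeries

namespace QSeries

open Finset

lemma map_finprod_inverse_qPoch {R S : Type*} [CommRing R] [CommRing S] {f : R →+* S}
    (hf : Function.Injective f) {q : R} (hq : ∀ n, IsUnit (qPoch q n)) (s : ℕ → ℕ) :
    f (∏ᶠ j, Ring.inverse (qPoch q (s j - s (j + 1))))
      = ∏ᶠ j, Ring.inverse (qPoch (f q) (s j - s (j + 1))) := by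
  refine ((f : R →* S).map_finprod_of_injective hf _).trans (finprod_congr fun j => ?_)
  rw [← map_qPoch]
  exact f.map_ringInverse (hq _)

/-- The weight of a tuple of descending sequences, as a power series in `q`. -/
noncomputable def intWeight {ι : Type*} [Fintype ι] (E : (ι → ℕ → ℕ) → ℤ) (r : ι → ℕ → ℕ) :
    PowerSeries ℤ :=
  PowerSeries.X ^ (E r).toNat
    * ∏ i, ∏ᶠ j, Ring.inverse (qPoch PowerSeries.X (r i j - r i (j + 1)))

lemma slice_term {l : ℕ} (E : (Fin l → ℕ → ℕ) → ℤ) (r : Fin l → ℕ → ℕ) :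
    slice l (MvPowerSeries.X 0 ^ (E r).toNat
        * (∏ i : Fin l, MvPowerSeries.X i.succ ^ (∑ᶠ t : ℕ, r i t))
        * ∏ i : Fin l, ∏ᶠ j : ℕ,
            Ring.inverse (qPoch (MvPowerSeries.X 0) (r i j - r i (j + 1))))
      = MvPowerSeries.monomial (Finsupp.equivFunOnFinite.symm fun i => ∑ᶠ t, r i t)
        (intWeight E r) := by
  have hC : MvPowerSeries.C (σ := Fin l) (intWeight E r) = MvPowerSeries.C PowerSeries.X ^ (E r).toNat
      * ∏ i, ∏ᶠ j, Ring.inverse (qPoch (MvPowerSeries.C PowerSeries.X) (r i j - r i (j + 1))) := by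
    rw [intWeight, map_mul, map_pow, map_prod]
    refine congrArg _ (prod_congr rfl fun i _ => ?_)
    exact map_finprod_inverse_qPoch MvPowerSeries.C_injective isUnit_qPoch_X (r i)
  rw [map_mul, map_mul, slice_prod_X_pow, map_pow, slice_X_zero, map_prod, mul_right_comm,
    prod_congr rfl fun i _ =>
      map_finprod_inverse_qPoch slice_injective (isUnit_qPoch_mvX 0) (r i), slice_X_zero, ← hC,
    ← MvPowerSeries.smul_eq_C_mul, ← map_smul, smul_eq_mul, mul_one]

/-- The generating function of tuples of descending sequences over `ℤ⟦q⟧`. -/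
noncomputable def intTupleSeries {ι : Type*} [Fintype ι] [DecidableEq ι]
    (E : (ι → ℕ → ℕ) → ℤ) : MvPowerSeries ι (PowerSeries ℤ) :=
  fun c => ∑ r ∈ rows c, intWeight E r

lemma coeff_intTupleSeries {ι : Type*} [Fintype ι] [DecidableEq ι]
    (E : (ι → ℕ → ℕ) → ℤ) (c : ι →₀ ℕ) :
    MvPowerSeries.coeff c (intTupleSeries E) = ∑ r ∈ rows c, intWeight E r :=
  rfl

lemma slice_tsum {l : ℕ} (E : (Fin l → ℕ → ℕ) → ℤ) :
    slice l (∑' r : {r : Fin l → ℕ → ℕ // ∀ i, IsDescending (r i)},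
      (MvPowerSeries.X 0 ^ (E r.1).toNat
        * (∏ i : Fin l, MvPowerSeries.X i.succ ^ (∑ᶠ t : ℕ, r.1 i t))
        * ∏ i : Fin l, ∏ᶠ j : ℕ,
            Ring.inverse (qPoch (MvPowerSeries.X 0) (r.1 i j - r.1 i (j + 1)))))
      = intTupleSeries E := by
  classical
  have : T2Space (MvPowerSeries (Fin (l + 1)) ℤ) := MvPowerSeries.WithPiTopology.instT2Space
  obtain ⟨S, hS⟩ := slice_surjective (intTupleSeries E)
  rw [← hS]
  refine congrArg _ (HasSum.tsum_eq ?_)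
  refine (MvPowerSeries.WithPiTopology.hasSum_iff_hasSum_coeff).2 fun d => ?_
  have hd : ∀ p : MvPowerSeries (Fin (l + 1)) ℤ, MvPowerSeries.coeff d p
      = PowerSeries.coeff (d 0) (MvPowerSeries.coeff d.tail (slice l p)) := fun p => by
    rw [coeff_coeff_slice, Finsupp.cons_tail]
  have hcoeff : ∀ r : Fin l → ℕ → ℕ, MvPowerSeries.coeff d.tail (MvPowerSeries.monomial
      (Finsupp.equivFunOnFinite.symm fun i => ∑ᶠ t, r i t) (intWeight E r))
      = if ∀ i, ∑ᶠ t, r i t = d.tail i then intWeight E r else 0 := fun r => by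
    rw [MvPowerSeries.coeff_monomial]
    exact if_congr ⟨fun h i => by rw [h]; rfl, fun h => Finsupp.ext fun i => (h i).symm⟩ rfl rfl
  have hsum : MvPowerSeries.coeff d S
      = ∑ r ∈ (rows d.tail).subtype fun r => ∀ i, IsDescending (r i),
      PowerSeries.coeff (d 0) (MvPowerSeries.coeff d.tail (MvPowerSeries.monomial
        (Finsupp.equivFunOnFinite.symm fun i => ∑ᶠ t, r.1 i t) (intWeight E r.1))) := by
    rw [hd, hS, coeff_intTupleSeries, map_sum, sum_subtype_of_mem
      (fun r => PowerSeries.coeff (d 0) (MvPowerSeries.coeff d.tail (MvPowerSeries.monomial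
        (Finsupp.equivFunOnFinite.symm fun i => ∑ᶠ t, r i t) (intWeight E r))))
      fun r hr => (mem_rows.1 hr).1]
    refine sum_congr rfl fun r hr => ?_
    rw [hcoeff, if_pos (mem_rows.1 hr).2]
  rw [hsum]
  simp_rw [hd, slice_term]
  refine hasSum_sum_of_ne_finset_zero fun r hr => ?_
  rw [hcoeff, if_neg fun h => hr (mem_subtype.2 (mem_rows.2 ⟨r.2, h⟩)), map_zero]

end QSeries

namespace QSeries

open Finset

section FractionRing

variable {ι : Type*} [Fintype ι]

local notation "ofSeries" => algebraMap (PowerSeries ℤ) (FractionRing (PowerSeries ℤ))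

lemma map_intWeight {E : (ι → ℕ → ℕ) → ℤ} {r : ι → ℕ → ℕ} (hr : 0 ≤ E r) :
    ofSeries (intWeight E r) = weight (ofSeries PowerSeries.X) E r := by
  rw [intWeight, weight, map_mul, map_pow, map_prod, ← zpow_natCast, Int.toNat_of_nonneg hr]
  refine congrArg _ (prod_congr rfl fun i _ => ?_)
  rw [map_finprod_inverse_qPoch (FaithfulSMul.algebraMap_injective _ _) isUnit_qPoch_X, invAut]
  simp only [Ring.inverse_eq_inv]

lemma map_eulerTail_zero :
    PowerSeries.map ofSeries (eulerTail 0) = eulerSeries (ofSeries PowerSeries.X) := by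
  ext k
  rw [PowerSeries.coeff_map, eulerTail, eulerSeries, PowerSeries.coeff_mk, PowerSeries.coeff_mk,
    map_mul, RingHom.map_ringInverse _ (isUnit_qPoch_X k), Ring.inverse_eq_inv, map_qPoch, map_pow,
    zero_add, mul_one]

lemma intTupleSeries_eq_prod [DecidableEq ι] {A : Matrix ι ι ℤ} (hA : A.IsSymm)
    (hdiag : ∀ i, A i i = 2) (hoff : ∀ i j, i ≠ j → A i j = 0 ∨ A i j = -1)
    (hpos : ∀ c : ι → ℤ, c ≠ 0 → 0 < bilForm A c c) {Φ : Finset (ι → ℕ)}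
    (hΦ : ∀ c : ι → ℕ, c ∈ Φ ↔ bilForm A (fun i => (c i : ℤ)) (fun i => (c i : ℤ)) = 2)
    {E : (ι → ℕ → ℕ) → ℤ}
    (hE : ∀ r, 2 * E r = ∑ᶠ t : ℕ, bilForm A (fun i => (r i t : ℤ)) fun i => (r i t : ℤ))
    (hE0 : ∀ r, 0 ≤ E r) :
    intTupleSeries E = ∏ α ∈ Φ, evalMonomial α (eulerTail 0) := by
  have hinj : Function.Injective ofSeries := FaithfulSMul.algebraMap_injective _ _
  have hX : ofSeries PowerSeries.X ≠ 0 := by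
    rw [Ne, map_eq_zero_iff _ hinj]
    exact PowerSeries.X_ne_zero
  have hXpow (n : ℕ) : ofSeries PowerSeries.X ^ (n + 1) ≠ 1 := by
    rw [← map_pow, Ne, map_eq_one_iff _ hinj]
    intro h
    simpa using congrArg PowerSeries.constantCoeff h
  have hΦ0 : ∀ α ∈ Φ, α ≠ 0 := by
    rintro α hα rfl
    simp [hΦ, bilForm] at hα
  have hmap : Function.Injective (MvPowerSeries.map (σ := ι) ofSeries) := fun p p' h => by
    ext1 c
    exact hinj (by simpa using congrArg (MvPowerSeries.coeff c) h)
  apply hmap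
  rw [map_prod, prod_congr rfl fun α hα => by
    rw [map_evalMonomial _ (hΦ0 α hα), map_eulerTail_zero],
    ← tupleSeries_eq_prod hX hXpow hA hdiag hoff hpos hΦ hE]
  ext c
  rw [MvPowerSeries.coeff_map, coeff_intTupleSeries, map_sum,
    sum_congr rfl fun r _ => map_intWeight (hE0 r)]
  rfl

end FractionRing

end QSeries

open MvPowerSeries

/-- Let `A` be the Cartan matrix of a simply-laced simple Lie algebra
(symmetric, `2` on the diagonal, off-diagonal entries in `{0, -1}`, positive definite,
connected Dynkin graph), and let `Φ⁺ = {c ∈ ℕ^l : cᵀ A c = 2}` be its (finite) set of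
positive roots in simple-root coordinates.  Then, in `ℤ[[q, y₁, …, y_l]]`
(variables indexed by `Fin (l+1)`, with `q = X 0` and `yᵢ = X i.succ`):
`∏_{c ∈ Φ⁺} ∏_{n ≥ 1} (1 - qⁿ y^c)⁻¹
   = ∑_{(r₁,…,r_l) descending} q^{E r} (∏ᵢ yᵢ^{|rᵢ|}) ∏ᵢ ∏_{j ≥ 1} (q;q)_{rᵢ^{(j)}-rᵢ^{(j+1)}}⁻¹`,
where `E r = ∑_{t ≥ 1} ½ (c^{(t)})ᵀ A c^{(t)}` with `c^{(t)} = (r₁^{(t)},…,r_l^{(t)})`,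
and each such `E r` is a nonnegative integer. -/
theorem stmt_3 (l : ℕ) (hl : 1 ≤ l) (A : Matrix (Fin l) (Fin l) ℤ)
    (hsymm : A.IsSymm)
    (hdiag : ∀ i, A i i = 2)
    (hoff : ∀ i j, i ≠ j → A i j = 0 ∨ A i j = -1)
    (hposdef : ∀ c : Fin l → ℤ, c ≠ 0 → 0 < ∑ i, ∑ j, c i * A i j * c j)
    (hconn : (SimpleGraph.fromRel fun i j => A i j = -1).Connected)
    (Φ : Finset (Fin l → ℕ))
    (hΦ : ∀ c : Fin l → ℕ, c ∈ Φ ↔ ∑ i, ∑ j, (c i : ℤ) * A i j * (c j : ℤ) = 2)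
    (E : (Fin l → ℕ → ℕ) → ℤ)
    (hE : ∀ r : Fin l → ℕ → ℕ,
      2 * E r = ∑ᶠ t : ℕ, ∑ i, ∑ j, (r i t : ℤ) * A i j * (r j t : ℤ)) :
    (∀ r : Fin l → ℕ → ℕ, (∀ i, IsDescending (r i)) → 0 ≤ E r)
    ∧ (∏ c ∈ Φ, ∏' n : ℕ,
          Ring.inverse (1 - (X 0 : MvPowerSeries (Fin (l+1)) ℤ) ^ (n + 1)
            * ∏ i : Fin l, (X i.succ : MvPowerSeries (Fin (l+1)) ℤ) ^ c i))
      = ∑' r : {r : Fin l → ℕ → ℕ // ∀ i, IsDescending (r i)},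
          (X 0 : MvPowerSeries (Fin (l+1)) ℤ) ^ (E r.1).toNat
            * (∏ i : Fin l, (X i.succ : MvPowerSeries (Fin (l+1)) ℤ) ^ (∑ᶠ t : ℕ, r.1 i t))
            * ∏ i : Fin l, ∏ᶠ j : ℕ,
                Ring.inverse (∏ u ∈ Finset.range (r.1 i j - r.1 i (j + 1)),
                  (1 - (X 0 : MvPowerSeries (Fin (l+1)) ℤ) ^ (u + 1))) := by
  have hE0 : ∀ r, 0 ≤ E r := fun r => by
    have h : (0 : ℤ) ≤ 2 * E r := by
      rw [hE]
      refine finsum_nonneg fun t => ?_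
      by_cases h : (fun i => (r i t : ℤ)) = 0
      · simp only [funext_iff, Pi.zero_apply] at h
        simp [h]
      · exact (hposdef _ h).le
    lia
  refine ⟨fun r _ => hE0 r, QSeries.slice_injective ?_⟩
  have hΦ0 : ∀ α ∈ Φ, α ≠ 0 := by
    rintro α hα rfl
    simp [hΦ] at hα
  rw [map_prod, Finset.prod_congr rfl fun α hα => QSeries.slice_tprod (hΦ0 α hα),
    ← QSeries.intTupleSeries_eq_prod hsymm hdiag hoff hposdef hΦ hE hE0]
  exact (QSeries.slice_tsum E).symm
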